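/- arXiv:2311.15043 — 2 statements merged into one kernel-verified Lean document; each statement's English description precedes it below -/
import Mathlib

section
/- For every set P ⊂ ℝ² of n ≥ 3 points in general position and every α ∈ (0,π/2], there exists a plane α-bend graph on P with at least 3n−7 edges, and there exists a plane α-bend graph on P with at least M(P) edges. -/
open EuclideanGeometry Real Set

noncomputable section

/-- The Euclidean plane. -/
abbrev Pt : Type := EuclideanSpace ℝ (Fin 2)

/-- The image of a one-bend edge `(a,b,c)`: the union of segments `[a,b]` and `[b,c]`. -/
def bendImage (e : Pt × Pt × Pt) : Set Pt :=
  segment ℝ e.1 e.2.1 ∪ segment ℝ e.2.1 e.2.2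

/-- The endpoints of a (bend or arc) edge `(a,b,c)` are `a` and `c`. -/
def edgeEndpoints (e : Pt × Pt × Pt) : Set Pt := {e.1, e.2.2}

/-- An `α`-bend edge: a triple `(a,b,c)` with `a ≠ c` and angle `α` at `b`. -/
def IsBendEdge (α : ℝ) (e : Pt × Pt × Pt) : Prop :=
  e.1 ≠ e.2.2 ∧ ∠ e.1 e.2.1 e.2.2 = α

/-- A plane `α`-bend multigraph on a finite vertex set `V`. -/
def IsPlaneBendMultigraph (α : ℝ) (V : Finset Pt) (E : Finset (Pt × Pt × Pt)) : Prop :=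
  (∀ e ∈ E, IsBendEdge α e ∧ e.1 ∈ V ∧ e.2.2 ∈ V) ∧
  (∀ e ∈ E, ∀ f ∈ E, e ≠ f → bendImage e ≠ bendImage f) ∧
  (∀ e ∈ E, ∀ v ∈ V, (v : Pt) ∈ bendImage e → (v : Pt) ∈ edgeEndpoints e) ∧
  (∀ e ∈ E, ∀ f ∈ E, e ≠ f →
    bendImage e ∩ bendImage f ⊆ edgeEndpoints e ∩ edgeEndpoints f)

/-- A plane `α`-bend graph: a plane `α`-bend multigraph in which distinct edges
have distinct endpoint pairs. -/
def IsPlaneBendGraph (α : ℝ) (V : Finset Pt) (E : Finset (Pt × Pt × Pt)) : Prop :=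
  IsPlaneBendMultigraph α V E ∧
  ∀ e ∈ E, ∀ f ∈ E, e ≠ f → edgeEndpoints e ≠ edgeEndpoints f

/-- An `α`-arc edge: a triple `(a,b,c)` with `a ≠ c`, `b` off of the line `ac`,
and angle `α` at `b`. -/
def IsArcEdge (α : ℝ) (e : Pt × Pt × Pt) : Prop :=
  e.1 ≠ e.2.2 ∧ e.2.1 ∉ affineSpan ℝ ({e.1, e.2.2} : Set Pt) ∧ ∠ e.1 e.2.1 e.2.2 = α

/-- The image of an arc edge `(a,b,c)`: `{a,c}` together with the points strictly on the
same side of line `ac` as `b` from which the segment `ac` subtends the same angle as at `b`. -/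
def arcImage (e : Pt × Pt × Pt) : Set Pt :=
  ({e.1, e.2.2} : Set Pt) ∪
    {x : Pt | (affineSpan ℝ ({e.1, e.2.2} : Set Pt)).SSameSide x e.2.1 ∧
      ∠ e.1 x e.2.2 = ∠ e.1 e.2.1 e.2.2}

/-- A plane `α`-arc multigraph on a finite vertex set `V`. -/
def IsPlaneArcMultigraph (α : ℝ) (V : Finset Pt) (E : Finset (Pt × Pt × Pt)) : Prop :=
  (∀ e ∈ E, IsArcEdge α e ∧ e.1 ∈ V ∧ e.2.2 ∈ V) ∧
  (∀ e ∈ E, ∀ f ∈ E, e ≠ f → arcImage e ≠ arcImage f) ∧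
  (∀ e ∈ E, ∀ v ∈ V, (v : Pt) ∈ arcImage e → (v : Pt) ∈ edgeEndpoints e) ∧
  (∀ e ∈ E, ∀ f ∈ E, e ≠ f →
    arcImage e ∩ arcImage f ⊆ edgeEndpoints e ∩ edgeEndpoints f)

/-- A plane `α`-arc graph: a plane `α`-arc multigraph in which distinct edges
have distinct endpoint pairs. -/
def IsPlaneArcGraph (α : ℝ) (V : Finset Pt) (E : Finset (Pt × Pt × Pt)) : Prop :=
  IsPlaneArcMultigraph α V E ∧
  ∀ e ∈ E, ∀ f ∈ E, e ≠ f → edgeEndpoints e ≠ edgeEndpoints f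

/-- A finite point set is in general position if no three of its points are collinear. -/
def GenPos (P : Finset Pt) : Prop :=
  ∀ p ∈ P, ∀ q ∈ P, ∀ r ∈ P, p ≠ q → p ≠ r → q ≠ r →
    ¬ Collinear ℝ ({p, q, r} : Set Pt)

/-- A planar straight-line graph on `P`: edges are (ordered representatives of unordered)
pairs of distinct points of `P` whose closed segments pairwise intersect only in shared
endpoints, and no segment contains a point of `P` other than its endpoints. -/
def IsPSLG (P : Finset Pt) (E : Finset (Pt × Pt)) : Prop :=
  (∀ e ∈ E, e.1 ∈ P ∧ e.2 ∈ P ∧ e.1 ≠ e.2) ∧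
  (∀ e ∈ E, ∀ f ∈ E, e ≠ f → segment ℝ e.1 e.2 ≠ segment ℝ f.1 f.2) ∧
  (∀ e ∈ E, ∀ p ∈ P, (p : Pt) ∈ segment ℝ e.1 e.2 → p = e.1 ∨ p = e.2) ∧
  (∀ e ∈ E, ∀ f ∈ E, e ≠ f →
    segment ℝ e.1 e.2 ∩ segment ℝ f.1 f.2 ⊆ ({e.1, e.2} : Set Pt) ∩ ({f.1, f.2} : Set Pt))

/-- `M P`: the maximum number of edges of a planar straight-line graph on `P`. -/
def M (P : Finset Pt) : ℕ :=
  sSup {m : ℕ | ∃ E : Finset (Pt × Pt), IsPSLG P E ∧ E.card = m}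

/-- Two segments (given by their endpoint pairs) cross: they meet in exactly one point,
which lies in the relative interior (open segment) of both. -/
def SegCross (s t : Pt × Pt) : Prop :=
  ∃ x : Pt, segment ℝ s.1 s.2 ∩ segment ℝ t.1 t.2 = {x} ∧
    x ∈ openSegment ℝ s.1 s.2 ∧ x ∈ openSegment ℝ t.1 t.2

section BendProof

open Filter Topology

noncomputable section


/-- Reciprocal slope of `b` seen from `a`. -/
def rsl (a b : Pt) : ℝ := (b 0 - a 0) / (b 1 - a 1)

lemma rsl_mul {a b : Pt} (h : a 1 < b 1) : rsl a b * (b 1 - a 1) = b 0 - a 0 := by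
  unfold rsl
  have : b 1 - a 1 ≠ 0 := by linarith
  field_simp

lemma mem_seg_coords {a c z : Pt} {t : ℝ} (h0 : 0 ≤ t) (h1 : t ≤ 1)
    (hx : z 0 = a 0 + t * (c 0 - a 0)) (hy : z 1 = a 1 + t * (c 1 - a 1)) :
    z ∈ segment ℝ a c := by
  rw [segment_eq_image']
  refine ⟨t, ⟨h0, h1⟩, ?_⟩
  ext i
  fin_cases i
  · simp [hx]
  · simp [hy]

lemma seg_coords {a c z : Pt} (h : z ∈ segment ℝ a c) :
    ∃ t : ℝ, 0 ≤ t ∧ t ≤ 1 ∧ z 0 = a 0 + t * (c 0 - a 0) ∧ z 1 = a 1 + t * (c 1 - a 1) := by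
  rw [segment_eq_image'] at h
  obtain ⟨t, ⟨h0, h1⟩, rfl⟩ := h
  exact ⟨t, h0, h1, by simp, by simp⟩

lemma mem_seg_of_pos {a c z : Pt} (h : a 1 < c 1) (h0 : a 1 ≤ z 1) (h1 : z 1 ≤ c 1)
    (hx : z 0 = a 0 + (z 1 - a 1) * rsl a c) : z ∈ segment ℝ a c := by
  have hp : 0 < c 1 - a 1 := by linarith
  refine mem_seg_coords (t := (z 1 - a 1) / (c 1 - a 1)) (by apply div_nonneg <;> linarith)
    (by rw [div_le_one hp]; linarith) ?_ ?_
  · rw [hx, rsl]; field_simp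
  · field_simp; ring

/-- Two segments that swap their horizontal order between heights `l` and `h` meet there. -/
lemma seg_cross {a c a' b : Pt} {l h : ℝ} (hlh : l < h) (h1 : a 1 ≤ l) (h2 : h ≤ c 1)
    (h3 : a' 1 ≤ l) (h4 : h ≤ b 1)
    (hl : a 0 + (l - a 1) * rsl a c < a' 0 + (l - a' 1) * rsl a' b)
    (hh : a' 0 + (h - a' 1) * rsl a' b < a 0 + (h - a 1) * rsl a c) :
    ∃ z : Pt, z ∈ segment ℝ a c ∧ z ∈ segment ℝ a' b ∧ l < z 1 ∧ z 1 < h := by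
  set d1 := (a' 0 + (l - a' 1) * rsl a' b) - (a 0 + (l - a 1) * rsl a c) with hd1
  set d2 := (a 0 + (h - a 1) * rsl a c) - (a' 0 + (h - a' 1) * rsl a' b) with hd2
  have p1 : 0 < d1 := by linarith
  have p2 : 0 < d2 := by linarith
  have hs : 0 < d1 + d2 := by linarith
  have hs' : d1 + d2 ≠ 0 := hs.ne'
  set y := (l * d2 + h * d1) / (d1 + d2) with hy
  have hyl : l < y := by rw [hy, lt_div_iff₀ hs]; nlinarith
  have hyh : y < h := by rw [hy, div_lt_iff₀ hs]; nlinarith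
  have hkey : a 0 + (y - a 1) * rsl a c = a' 0 + (y - a' 1) * rsl a' b := by
    have e : y * (d1 + d2) = l * d2 + h * d1 := by rw [hy]; field_simp
    have e2 : (h - l) * (rsl a c - rsl a' b) = d1 + d2 := by rw [hd1, hd2]; ring
    have e3 : (h-l) * (y * (rsl a c - rsl a' b)) = l * d2 + h * d1 := by
      rw [← e, ← e2]; ring
    have hne : h - l ≠ 0 := by linarith
    have : (h - l) * ((a 0 + (y - a 1) * rsl a c) - (a' 0 + (y - a' 1) * rsl a' b)) = 0 := by
      have : (h - l) * ((a 0 + (y - a 1) * rsl a c) - (a' 0 + (y - a' 1) * rsl a' b))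
        = (h - l) * (y * (rsl a c - rsl a' b)) +
          (h - l) * ((a 0 - a 1 * rsl a c) - (a' 0 - a' 1 * rsl a' b)) := by ring
      rw [this, e3, hd1, hd2]; ring
    have := (mul_eq_zero.mp this).resolve_left hne
    linarith
  refine ⟨!₂[a 0 + (y - a 1) * rsl a c, y], ?_, ?_, by simpa using hyl, by simpa using hyh⟩
  · exact mem_seg_of_pos (by linarith) (by simp; linarith) (by simp; linarith) (by simp)
  · exact mem_seg_of_pos (by linarith) (by simp; linarith) (by simp; linarith) (by simpa using hkey)

/-- Oriented straight-line graph. -/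
structure OPSLG (P : Finset Pt) (E : Finset (Pt × Pt)) : Prop where
  mem1 : ∀ e ∈ E, e.1 ∈ P
  mem2 : ∀ e ∈ E, e.2 ∈ P
  lt : ∀ e ∈ E, e.1 1 < e.2 1
  vert : ∀ e ∈ E, ∀ p ∈ P, p ∈ segment ℝ e.1 e.2 → p = e.1 ∨ p = e.2
  cross : ∀ e ∈ E, ∀ f ∈ E, e ≠ f →
    segment ℝ e.1 e.2 ∩ segment ℝ f.1 f.2 ⊆ ({e.1, e.2} : Set Pt) ∩ ({f.1, f.2} : Set Pt)

lemma OPSLG.slope_inj {P : Finset Pt} {E : Finset (Pt × Pt)} (h : OPSLG P E) {a b c : Pt}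
    (hb : (a, b) ∈ E) (hc : (a, c) ∈ E) (hs : rsl a b = rsl a c) : b = c := by
  wlog hle : b 1 ≤ c 1 generalizing b c
  · exact (this hc hb hs.symm (by linarith)).symm
  have h1 := h.lt _ hb
  have h2 := h.lt _ hc
  have hm : b ∈ segment ℝ a c := by
    refine mem_seg_of_pos h2 h1.le hle ?_
    rw [← hs, mul_comm, rsl_mul h1]; ring
  rcases h.vert _ hc b (h.mem2 _ hb) hm with h3 | h3
  · simp only at h3; rw [h3] at h1; simp at h1
  · exact h3

/-- No crossing of two edges under the wedge conditions. -/
lemma OPSLG.noswap {P : Finset Pt} {E : Finset (Pt × Pt)} (h : OPSLG P E) {a b a' c m : Pt}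
    (hc : (a, c) ∈ E) (hb : (a', b) ∈ E) (h1 : a 1 < a' 1) (h2 : a' 1 < m 1) (h3 : m 1 ≤ c 1)
    (h4 : m 1 ≤ b 1) :
    (rsl a c < rsl a a' → rsl a m ≤ rsl a c → rsl a' b ≤ rsl a' m →
      rsl a m < rsl a c ∨ rsl a' b < rsl a' m → False) ∧
    (rsl a a' < rsl a c → rsl a c ≤ rsl a m → rsl a' m ≤ rsl a' b →
      rsl a c < rsl a m ∨ rsl a' m < rsl a' b → False) := by
  have ea := rsl_mul h1
  have em := rsl_mul (h1.trans h2)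
  have em' := rsl_mul h2
  have fin : ∀ z : Pt, z ∈ segment ℝ a c → z ∈ segment ℝ a' b → a' 1 < z 1 → z 1 < m 1 → False := by
    intro z z1 z2 z3 z4
    have hne : (a, c) ≠ (a', b) := by
      intro he
      simp only [Prod.mk.injEq] at he
      rw [he.1] at h1; exact lt_irrefl _ h1
    have := (h.cross _ hc _ hb hne ⟨z1, z2⟩).1
    simp only [Set.mem_insert_iff, Set.mem_singleton_iff] at this
    rcases this with rfl | rfl <;> linarith
  have p1 : 0 < a' 1 - a 1 := by linarith
  have p2 : 0 < m 1 - a' 1 := by linarith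
  have p3 : 0 < m 1 - a 1 := by linarith
  constructor
  · intro k1 k2 k3 k4
    have i1 := mul_lt_mul_of_pos_right k1 p1
    have i2 := mul_le_mul_of_nonneg_right k2 p3.le
    have i3 := mul_le_mul_of_nonneg_right k3 p2.le
    obtain ⟨z, z1, z2, z3, z4⟩ := seg_cross (a := a) (c := c) (a' := a') (b := b) h2 h1.le h3 le_rfl h4
      (by linarith) (by
        rcases k4 with k4 | k4
        · have i4 := mul_lt_mul_of_pos_right k4 p3
          linarith
        · have i4 := mul_lt_mul_of_pos_right k4 p2
          linarith)
    exact fin z z1 z2 z3 z4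
  · intro k1 k2 k3 k4
    have i1 := mul_lt_mul_of_pos_right k1 p1
    have i2 := mul_le_mul_of_nonneg_right k2 p3.le
    have i3 := mul_le_mul_of_nonneg_right k3 p2.le
    obtain ⟨z, z1, z2, z3, z4⟩ := seg_cross (a := a') (c := b) (a' := a) (b := c) h2 le_rfl h4 h1.le h3
      (by linarith) (by
        rcases k4 with k4 | k4
        · have i4 := mul_lt_mul_of_pos_right k4 p3
          linarith
        · have i4 := mul_lt_mul_of_pos_right k4 p2
          linarith)
    exact fin z z2 z1 z3 z4

/-- A wedge: consecutive edges `(a,b)`, `(a,c)` and the first point `m` between them. -/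
structure Wedge (P : Finset Pt) (E : Finset (Pt × Pt)) (a b c m : Pt) : Prop where
  hb : (a, b) ∈ E
  hc : (a, c) ∈ E
  lt : rsl a b < rsl a c
  next : ∀ d, (a, d) ∈ E → rsl a b < rsl a d → rsl a c ≤ rsl a d
  mP : m ∈ P
  m1 : a 1 < m 1
  mb : m 1 ≤ b 1
  mc : m 1 ≤ c 1
  ml : rsl a b ≤ rsl a m
  mr : rsl a m ≤ rsl a c
  first : ∀ x ∈ P, a 1 < x 1 → x 1 < m 1 → rsl a b ≤ rsl a x → rsl a x ≤ rsl a c → False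

lemma OPSLG.exists_wedge {P : Finset Pt} {E : Finset (Pt × Pt)} (h : OPSLG P E) {a b : Pt}
    (hb : (a, b) ∈ E) (hnt : ∃ c, (a, c) ∈ E ∧ rsl a b < rsl a c) :
    ∃ c m, Wedge P E a b c m := by
  classical
  obtain ⟨c0, hc0, hlt0⟩ := hnt
  obtain ⟨e, he, hmin⟩ := Finset.exists_min_image
    (E.filter (fun e => e.1 = a ∧ rsl a b < rsl a e.2)) (fun e => rsl a e.2)
    ⟨(a, c0), by simp [hc0, hlt0]⟩
  simp only [Finset.mem_filter] at he hmin
  obtain ⟨a', c⟩ := e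
  obtain ⟨he, rfl, hlt⟩ := he
  simp only at *
  have b1 := h.lt _ hb
  have c1 := h.lt _ he
  simp only at b1 c1
  obtain ⟨m, hm, hmm⟩ := Finset.exists_min_image
    (P.filter (fun x => a' 1 < x 1 ∧ x 1 ≤ b 1 ∧ x 1 ≤ c 1 ∧ rsl a' b ≤ rsl a' x ∧ rsl a' x ≤ rsl a' c))
    (fun x => x 1) (by
      rcases le_total (b 1) (c 1) with hh | hh
      · exact ⟨b, by simp [h.mem2 _ hb, b1, hh, hlt.le]⟩
      · exact ⟨c, by simp [h.mem2 _ he, c1, hh, hlt.le]⟩)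
  simp only [Finset.mem_filter] at hm hmm
  obtain ⟨hP, m1, m2, m3, m4, m5⟩ := hm
  refine ⟨c, m, ⟨hb, he, hlt, ?_, hP, m1, m2, m3, m4, m5, ?_⟩⟩
  · intro d hd hd'
    exact hmin (a', d) ⟨hd, rfl, hd'⟩
  · intro x hx x1 x2 x3 x4
    have := hmm x ⟨hx, x1, by linarith, by linarith, x3, x4⟩
    linarith

lemma OPSLG.wedge_inj {P : Finset Pt} {E : Finset (Pt × Pt)} (h : OPSLG P E) {a b c a' b' c' m : Pt}
    (w : Wedge P E a b c m) (w' : Wedge P E a' b' c' m)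
    (yinj : ∀ p ∈ P, ∀ q ∈ P, p 1 = q 1 → p = q)
    (hty : rsl a m = rsl a c ↔ rsl a' m = rsl a' c') : (a, b) = (a', b') := by
  have key : ∀ {a b c a' b' c' : Pt}, Wedge P E a b c m → Wedge P E a' b' c' m →
      (rsl a m = rsl a c ↔ rsl a' m = rsl a' c') → ¬ a 1 < a' 1 := by
    intro a b c a' b' c' w w' hty hlt
    by_cases hh : rsl a a' ≤ rsl a c
    · have h2 : rsl a a' < rsl a b := by
        by_contra hcon
        exact w.first a' (h.mem1 _ w'.hb) hlt w'.m1 (not_lt.mp hcon) hh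
      refine (h.noswap w.hb w'.hc hlt w'.m1 w.mb w'.mc).2 h2 w.ml w'.mr ?_
      by_cases ht : rsl a m = rsl a c
      · left; rw [ht]; exact w.lt
      · right; exact lt_of_le_of_ne w'.mr (fun hx => ht (hty.2 hx))
    · refine (h.noswap w.hc w'.hb hlt w'.m1 w.mc w'.mb).1 (not_le.mp hh) w.mr w'.ml ?_
      by_cases ht : rsl a m = rsl a c
      · right; rw [hty.1 ht]; exact w'.lt
      · left; exact lt_of_le_of_ne w.mr ht
  have e1 := key w w' hty
  have e2 := key w' w hty.symm
  have haa : a = a' := yinj _ (h.mem1 _ w.hb) _ (h.mem1 _ w'.hb) (le_antisymm (not_lt.mp e2) (not_lt.mp e1))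
  subst haa
  have key2 : ∀ {b c b' c' : Pt}, Wedge P E a b c m → Wedge P E a b' c' m →
      (rsl a m = rsl a c ↔ rsl a m = rsl a c') → ¬ rsl a b < rsl a b' := by
    intro b c b' c' w w' hty hlt
    have i1 := w.next _ w'.hb hlt
    have i2 := w'.ml
    have i3 := w.mr
    have i4 := w'.lt
    have : rsl a m = rsl a c := le_antisymm i3 (by linarith)
    have := hty.1 this
    linarith
  have e1 := key2 w w' hty
  have e2 := key2 w' w hty.symm
  have := h.slope_inj w.hb w'.hb (le_antisymm (not_lt.mp e2) (not_lt.mp e1))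
  rw [this]


/-- A coordinate frame adapted to the point set: `v` is the lowest and `w` the highest point,
all coordinates are distinct, and no other point has its abscissa between those of `v`, `w`. -/
structure NiceFrame (α : ℝ) (P : Finset Pt) (v w : Pt) : Prop where
  hv : v ∈ P
  hw : w ∈ P
  vw : v 1 < w 1
  xinj : ∀ p ∈ P, ∀ q ∈ P, p 0 = q 0 → p = q
  yinj : ∀ p ∈ P, ∀ q ∈ P, p 1 = q 1 → p = q
  mid : ∀ q ∈ P, q ≠ v → q ≠ w → v 1 < q 1 ∧ q 1 < w 1
  side : ∀ q ∈ P, q ≠ v → q ≠ w → (v 0 < q 0 ∧ w 0 < q 0) ∨ (q 0 < v 0 ∧ q 0 < w 0)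
  steep : |w 0 - v 0| * cos α < sin α * (w 1 - v 1)

/-- Points on the right. -/
def rightPts (P : Finset Pt) (v w : Pt) : Finset Pt := P.filter (fun q => v 0 < q 0 ∧ w 0 < q 0)
/-- Points on the left. -/
def leftPts (P : Finset Pt) (v w : Pt) : Finset Pt := P.filter (fun q => q 0 < v 0 ∧ q 0 < w 0)

open Classical in
lemma NiceFrame.card {α : ℝ} {P : Finset Pt} {v w : Pt} (nf : NiceFrame α P v w) :
    P.card = (rightPts P v w).card + (leftPts P v w).card + 2 := by
  have hne : v ≠ w := fun h => by have := nf.vw; rw [h] at this; exact lt_irrefl _ this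
  have h1 : P = (rightPts P v w ∪ leftPts P v w) ∪ {v, w} := by
    ext p
    simp only [rightPts, leftPts, Finset.mem_union, Finset.mem_filter, Finset.mem_insert,
      Finset.mem_singleton]
    constructor
    · intro hp
      by_cases h1 : p = v
      · simp [h1]
      by_cases h2 : p = w
      · simp [h2]
      rcases nf.side p hp h1 h2 with h | h
      · exact Or.inl (Or.inl ⟨hp, h⟩)
      · exact Or.inl (Or.inr ⟨hp, h⟩)
    · rintro ((h | h) | (h | h))
      · exact h.1
      · exact h.1
      · rw [h]; exact nf.hv
      · rw [h]; exact nf.hw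
  have d1 : Disjoint (rightPts P v w ∪ leftPts P v w) {v, w} := by
    rw [Finset.disjoint_left]
    intro p
    simp only [rightPts, leftPts, Finset.mem_union, Finset.mem_filter, Finset.mem_insert,
      Finset.mem_singleton]
    rintro (⟨_, h, h'⟩ | ⟨_, h, h'⟩) (rfl | rfl) <;> linarith
  have d2 : Disjoint (rightPts P v w) (leftPts P v w) := by
    rw [Finset.disjoint_left]
    intro p
    simp only [rightPts, leftPts, Finset.mem_filter]
    rintro ⟨_, h, h'⟩ ⟨_, h2, h3⟩
    linarith
  conv_lhs => rw [h1]
  rw [Finset.card_union_of_disjoint d1, Finset.card_union_of_disjoint d2, Finset.card_pair hne]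

/-- Linear functional vanishing in the direction `vw`. -/
def Ffun (v w p : Pt) : ℝ := p 0 * (w 1 - v 1) - p 1 * (w 0 - v 0)

lemma wedge_right {P : Finset Pt} {E : Finset (Pt × Pt)} (h : OPSLG P E) {v w a b c u : Pt}
    (hvw : v 1 < w 1) (hW : Wedge P E a b c u) (hu : ∀ p ∈ P, Ffun v w p ≤ Ffun v w u) :
    rsl a u = rsl a c := by
  by_contra hne
  have hlt := lt_of_le_of_ne hW.mr hne
  have ha := hu a (h.mem1 _ hW.hb)
  have hc := hu c (h.mem2 _ hW.hc)
  have h1 := rsl_mul hW.m1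
  have hac := lt_of_lt_of_le hW.m1 hW.mc
  have h2 := rsl_mul hac
  have hmc := hW.mc
  have hm1 := hW.m1
  unfold Ffun at ha hc
  set r := rsl a c
  set r' := rsl a u
  have p1 : 0 < u 1 - a 1 := by linarith
  have i1 : 0 < (r - r') * (u 1 - a 1) * (w 1 - v 1) := by
    apply mul_pos (mul_pos _ p1) <;> linarith
  have i2 : 0 ≤ (c 1 - u 1) * ((u 0 * (w 1 - v 1) - u 1 * (w 0 - v 0)) - (a 0 * (w 1 - v 1) - a 1 * (w 0 - v 0))) :=
    mul_nonneg (by linarith) (by linarith)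
  have i3 : 0 ≤ (u 1 - a 1) * ((u 0 * (w 1 - v 1) - u 1 * (w 0 - v 0)) - (c 0 * (w 1 - v 1) - c 1 * (w 0 - v 0))) :=
    mul_nonneg (by linarith) (by linarith)
  have i4 : 0 < (c 1 - a 1) * ((r - r') * (u 1 - a 1) * (w 1 - v 1)) := mul_pos (by linarith) i1
  have eu : u 0 = a 0 + r' * (u 1 - a 1) := by linarith
  have ec : c 0 = a 0 + r * (c 1 - a 1) := by linarith
  rw [eu] at i2 i3
  rw [ec] at i3
  nlinarith

lemma wedge_left {P : Finset Pt} {E : Finset (Pt × Pt)} (h : OPSLG P E) {v w a b c u : Pt}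
    (hvw : v 1 < w 1) (hW : Wedge P E a b c u) (hu : ∀ p ∈ P, Ffun v w u ≤ Ffun v w p) :
    rsl a b = rsl a u := by
  by_contra hne
  have hlt := lt_of_le_of_ne hW.ml hne
  have ha := hu a (h.mem1 _ hW.hb)
  have hc := hu b (h.mem2 _ hW.hb)
  have h1 := rsl_mul hW.m1
  have hac := lt_of_lt_of_le hW.m1 hW.mb
  have h2 := rsl_mul hac
  have hmc := hW.mb
  have hm1 := hW.m1
  unfold Ffun at ha hc
  set r := rsl a b
  set r' := rsl a u
  have p1 : 0 < u 1 - a 1 := by linarith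
  have i1 : 0 < (r' - r) * (u 1 - a 1) * (w 1 - v 1) := by
    apply mul_pos (mul_pos _ p1) <;> linarith
  have i2 : 0 ≤ (b 1 - u 1) * ((a 0 * (w 1 - v 1) - a 1 * (w 0 - v 0)) - (u 0 * (w 1 - v 1) - u 1 * (w 0 - v 0))) :=
    mul_nonneg (by linarith) (by linarith)
  have i3 : 0 ≤ (u 1 - a 1) * ((b 0 * (w 1 - v 1) - b 1 * (w 0 - v 0)) - (u 0 * (w 1 - v 1) - u 1 * (w 0 - v 0))) :=
    mul_nonneg (by linarith) (by linarith)
  have i4 : 0 < (b 1 - a 1) * ((r' - r) * (u 1 - a 1) * (w 1 - v 1)) := mul_pos (by linarith) i1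
  have eu : u 0 = a 0 + r' * (u 1 - a 1) := by linarith
  have ec : b 0 = a 0 + r * (b 1 - a 1) := by linarith
  rw [eu] at i2 i3
  rw [ec] at i3
  nlinarith

lemma NiceFrame.ge_v {α : ℝ} {P : Finset Pt} {v w : Pt} (nf : NiceFrame α P v w) {p : Pt}
    (hp : p ∈ P) : v 1 ≤ p 1 := by
  by_cases h1 : p = v
  · rw [h1]
  by_cases h2 : p = w
  · rw [h2]; exact nf.vw.le
  exact (nf.mid p hp h1 h2).1.le

lemma NiceFrame.le_w {α : ℝ} {P : Finset Pt} {v w : Pt} (nf : NiceFrame α P v w) {p : Pt}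
    (hp : p ∈ P) : p 1 ≤ w 1 := by
  by_cases h1 : p = v
  · rw [h1]; exact nf.vw.le
  by_cases h2 : p = w
  · rw [h2]
  exact (nf.mid p hp h1 h2).2.le

lemma NiceFrame.exists_right {α : ℝ} {P : Finset Pt} {v w : Pt} (nf : NiceFrame α P v w)
    (hne : (rightPts P v w).Nonempty) :
    ∃ u ∈ P, u ≠ v ∧ u ≠ w ∧ ∀ p ∈ P, Ffun v w p ≤ Ffun v w u := by
  obtain ⟨u, hu, hmax⟩ := Finset.exists_max_image P (Ffun v w) ⟨v, nf.hv⟩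
  obtain ⟨q, hq⟩ := hne
  simp only [rightPts, Finset.mem_filter] at hq
  obtain ⟨hq, q1, q2⟩ := hq
  have hqu := hmax q hq
  have a1 := nf.ge_v hq
  have a2 := nf.le_w hq
  have hvw := nf.vw
  have hqv : Ffun v w v < Ffun v w q := by
    unfold Ffun
    rcases lt_or_eq_of_le a1 with a1 | a1
    · nlinarith [mul_nonneg (sub_nonneg.2 a2) (sub_nonneg.2 q1.le), mul_pos (sub_pos.2 a1) (sub_pos.2 q2)]
    · rw [← a1]; nlinarith
  have hFF : Ffun v w v = Ffun v w w := by unfold Ffun; ring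
  refine ⟨u, hu, ?_, ?_, hmax⟩
  · rintro rfl; linarith
  · rintro rfl; linarith

lemma NiceFrame.exists_left {α : ℝ} {P : Finset Pt} {v w : Pt} (nf : NiceFrame α P v w)
    (hne : (leftPts P v w).Nonempty) :
    ∃ u ∈ P, u ≠ v ∧ u ≠ w ∧ ∀ p ∈ P, Ffun v w u ≤ Ffun v w p := by
  obtain ⟨u, hu, hmax⟩ := Finset.exists_min_image P (Ffun v w) ⟨v, nf.hv⟩
  obtain ⟨q, hq⟩ := hne
  simp only [leftPts, Finset.mem_filter] at hq
  obtain ⟨hq, q1, q2⟩ := hq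
  have hqu := hmax q hq
  have a1 := nf.ge_v hq
  have a2 := nf.le_w hq
  have hvw := nf.vw
  have hqv : Ffun v w q < Ffun v w v := by
    unfold Ffun
    rcases lt_or_eq_of_le a1 with a1 | a1
    · nlinarith [mul_nonneg (sub_nonneg.2 a2) (sub_nonneg.2 q1.le), mul_pos (sub_pos.2 a1) (sub_pos.2 q2)]
    · rw [← a1]; nlinarith
  have hFF : Ffun v w v = Ffun v w w := by unfold Ffun; ring
  refine ⟨u, hu, ?_, ?_, hmax⟩
  · rintro rfl; linarith
  · rintro rfl; linarith

open Classical in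
theorem OPSLG.card_le {α : ℝ} {P : Finset Pt} {E : Finset (Pt × Pt)} {v w : Pt} (h : OPSLG P E)
    (nf : NiceFrame α P v w) :
    E.card ≤ 2 * (P.card - 2) + 1 + ((rightPts P v w).card - 1) + ((leftPts P v w).card - 1) := by
  have hvw : v ≠ w := fun h => by have := nf.vw; rw [h] at this; exact lt_irrefl _ this
  set T := E.filter (fun e => ¬ ∃ c, (e.1, c) ∈ E ∧ rsl e.1 e.2 < rsl e.1 c) with hT
  set N := E.filter (fun e => ∃ c, (e.1, c) ∈ E ∧ rsl e.1 e.2 < rsl e.1 c) with hN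
  have hcard : E.card = N.card + T.card := by
    rw [hN, hT, Finset.card_filter_add_card_filter_not]
  have hTc : T.card ≤ P.card - 1 := by
    rw [← Finset.card_erase_of_mem nf.hw]
    refine Finset.card_le_card_of_injOn (fun e => e.1) ?_ ?_
    · intro e he
      simp only [hT, Finset.coe_filter, Set.mem_ofPred_eq] at he
      have := h.lt _ he.1
      simp only [Finset.coe_erase, Set.mem_sdiff, Finset.mem_coe, Set.mem_singleton_iff]
      refine ⟨h.mem1 _ he.1, fun hh => ?_⟩
      have h2 := nf.le_w (h.mem2 _ he.1)
      rw [hh] at this; linarith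
    · rintro ⟨a, b⟩ he ⟨a', b'⟩ he' heq
      simp only [hT, Finset.coe_filter, Set.mem_ofPred_eq, not_exists, not_and, not_lt] at he he' heq
      subst heq
      have := h.slope_inj he.1 he'.1 (le_antisymm (he'.2 _ he.1) (he.2 _ he'.1))
      rw [this]
  have hex : ∀ e : Pt × Pt, ∃ cm : Pt × Pt, e ∈ N → Wedge P E e.1 e.2 cm.1 cm.2 := by
    intro e
    by_cases he : e ∈ N
    · simp only [hN, Finset.mem_filter] at he
      obtain ⟨c, m, hw⟩ := h.exists_wedge (a := e.1) (b := e.2) he.1 he.2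
      exact ⟨(c, m), fun _ => hw⟩
    · exact ⟨(v, v), fun h => absurd h he⟩
  choose g hg using hex
  set S1 : Finset (Pt × Bool) := ((P.erase v).erase w) ×ˢ (Finset.univ : Finset Bool) with hS1
  have hS1c : S1.card = 2 * (P.card - 2) := by
    rw [hS1, Finset.card_product, Finset.card_erase_of_mem (by simp [hvw.symm, nf.hw]),
      Finset.card_erase_of_mem nf.hv]
    simp; omega
  have hSR : ∃ A : Finset (Pt × Bool), A ⊆ S1 ∧ A.card = min 1 (rightPts P v w).card ∧
      ∀ x ∈ A, x.2 = false ∧ ∀ p ∈ P, Ffun v w p ≤ Ffun v w x.1 := by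
    rcases (rightPts P v w).eq_empty_or_nonempty with he | he
    · exact ⟨∅, by simp, by simp [he], by simp⟩
    · obtain ⟨u, hu, u1, u2, hmax⟩ := nf.exists_right he
      refine ⟨{(u, false)}, by simp [hS1, hu, u1, u2], ?_, ?_⟩
      · have := Finset.card_pos.2 he
        simp; omega
      · simpa using hmax
  have hSL : ∃ A : Finset (Pt × Bool), A ⊆ S1 ∧ A.card = min 1 (leftPts P v w).card ∧
      ∀ x ∈ A, x.2 = true ∧ ∀ p ∈ P, Ffun v w x.1 ≤ Ffun v w p := by
    rcases (leftPts P v w).eq_empty_or_nonempty with he | he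
    · exact ⟨∅, by simp, by simp [he], by simp⟩
    · obtain ⟨u, hu, u1, u2, hmax⟩ := nf.exists_left he
      refine ⟨{(u, true)}, by simp [hS1, hu, u1, u2], ?_, ?_⟩
      · have := Finset.card_pos.2 he
        simp; omega
      · simpa using hmax
  obtain ⟨A, hA1, hA2, hA3⟩ := hSR
  obtain ⟨B, hB1, hB2, hB3⟩ := hSL
  have hAB : Disjoint A B := by
    rw [Finset.disjoint_left]
    intro x hx hx'
    have := (hA3 x hx).1
    rw [(hB3 x hx').1] at this
    cases this
  have hNc : N.card ≤ (S1 \ (A ∪ B)).card := by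
    refine Finset.card_le_card_of_injOn
      (fun e => ((g e).2, decide (rsl e.1 (g e).2 = rsl e.1 (g e).1))) ?_ ?_
    · intro e he
      have hW := hg e he
      have mP := hW.mP
      have hmv : (g e).2 ≠ v := by
        intro hh
        have h1 := hW.m1
        have h2 := nf.ge_v (h.mem1 _ hW.hb)
        simp only at h2
        rw [hh] at h1; linarith
      have hmw : (g e).2 ≠ w := by
        intro hh
        have h1 := hW.mb
        have h2 := hW.mc
        rw [hh] at h1 h2
        have e1 := nf.yinj _ (h.mem2 _ hW.hb) _ nf.hw (le_antisymm (nf.le_w (h.mem2 _ hW.hb)) h1)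
        have e2 := nf.yinj _ (h.mem2 _ hW.hc) _ nf.hw (le_antisymm (nf.le_w (h.mem2 _ hW.hc)) h2)
        simp only at e1 e2
        have := hW.lt
        rw [e1, e2] at this
        exact lt_irrefl _ this
      simp only [Finset.coe_sdiff, Set.mem_sdiff, Finset.mem_coe]
      refine ⟨by simp [hS1, hmv, hmw, mP, Classical.em], ?_⟩
      rw [Finset.mem_union]
      rintro (hx | hx)
      · obtain ⟨h1, h2⟩ := hA3 _ hx
        simp only [decide_eq_false_iff_not] at h1
        exact h1 (wedge_right h nf.vw hW h2)
      · obtain ⟨h1, h2⟩ := hB3 _ hx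
        simp only [decide_eq_true_eq] at h1
        have := wedge_left h nf.vw hW h2
        have h3 := hW.lt
        linarith
    · intro e he e' he' heq
      simp only [Prod.mk.injEq, decide_eq_decide] at heq
      have w1 := hg e he
      have w2 := hg e' he'
      obtain ⟨q1, q2⟩ := heq
      rw [← q1] at w2
      exact h.wedge_inj w1 w2 nf.yinj (by rw [q2, ← q1])
  have hsub : A ∪ B ⊆ S1 := Finset.union_subset hA1 hB1
  rw [Finset.card_sdiff_of_subset hsub, Finset.card_union_of_disjoint hAB, hS1c, hA2, hB2] at hNc
  have := nf.card
  omega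

open Classical in
theorem PSLG_card_le {α : ℝ} {P : Finset Pt} {E : Finset (Pt × Pt)} {v w : Pt} (h : IsPSLG P E)
    (nf : NiceFrame α P v w) :
    E.card ≤ 2 * (P.card - 2) + 1 + ((rightPts P v w).card - 1) + ((leftPts P v w).card - 1) := by
  obtain ⟨h1, h2, h3, h4⟩ := h
  set o : Pt × Pt → Pt × Pt := fun e => if e.1 1 < e.2 1 then e else (e.2, e.1) with ho
  have hseg : ∀ e, segment ℝ (o e).1 (o e).2 = segment ℝ e.1 e.2 := by
    intro e
    simp only [ho]
    split_ifs
    · rfl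
    · exact segment_symm _ _ _
  have hpair : ∀ e, ({(o e).1, (o e).2} : Set Pt) = {e.1, e.2} := by
    intro e
    simp only [ho]
    split_ifs
    · rfl
    · exact Set.pair_comm _ _
  have hinj : Set.InjOn o E := by
    intro e he f hf hef
    by_contra hne
    apply h2 e he f hf hne
    rw [← hseg e, ← hseg f, hef]
  rw [← Finset.card_image_of_injOn hinj]
  refine OPSLG.card_le ⟨?_, ?_, ?_, ?_, ?_⟩ nf
  · intro e he
    obtain ⟨f, hf, rfl⟩ := Finset.mem_image.1 he
    have := h1 f hf
    simp only [ho]; split_ifs <;> tauto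
  · intro e he
    obtain ⟨f, hf, rfl⟩ := Finset.mem_image.1 he
    have := h1 f hf
    simp only [ho]; split_ifs <;> tauto
  · intro e he
    obtain ⟨f, hf, rfl⟩ := Finset.mem_image.1 he
    obtain ⟨q1, q2, q3⟩ := h1 f hf
    simp only [ho]
    split_ifs with hh
    · exact hh
    · exact lt_of_le_of_ne (not_lt.1 hh) (fun hx => q3 (nf.yinj _ q1 _ q2 hx.symm))
  · intro e he p hp
    obtain ⟨f, hf, rfl⟩ := Finset.mem_image.1 he
    rw [hseg]
    intro hm
    have : p ∈ ({f.1, f.2} : Set Pt) := by simpa using h3 f hf p hp hm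
    rw [← hpair] at this
    simpa using this
  · intro e he e' he' hne
    obtain ⟨f, hf, rfl⟩ := Finset.mem_image.1 he
    obtain ⟨f', hf', rfl⟩ := Finset.mem_image.1 he'
    rw [hseg, hseg, hpair, hpair]
    exact h4 f hf f' hf' (fun hx => hne (by rw [hx]))


lemma bend_coords {a b c p : Pt} (h : p ∈ bendImage (a, b, c)) :
    (∃ t : ℝ, 0 ≤ t ∧ t ≤ 1 ∧ p 0 = a 0 + t * (b 0 - a 0) ∧ p 1 = a 1 + t * (b 1 - a 1)) ∨
    (∃ t : ℝ, 0 ≤ t ∧ t ≤ 1 ∧ p 0 = c 0 + t * (b 0 - c 0) ∧ p 1 = c 1 + t * (b 1 - c 1)) := by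
  rcases h with h | h
  · exact Or.inl (seg_coords h)
  · rw [segment_symm] at h
    exact Or.inr (seg_coords h)

lemma angle_of_coords {α : ℝ} (hα : α ∈ Set.Ioc 0 (π/2)) {a b c : Pt} {s t sx sy tx ty : ℝ}
    (hs : 0 < s) (ht : 0 < t)
    (ha0 : b 0 - a 0 = s * sx) (ha1 : b 1 - a 1 = s * sy)
    (hc0 : b 0 - c 0 = t * tx) (hc1 : b 1 - c 1 = t * ty)
    (ns : sx ^ 2 + sy ^ 2 = 1) (nt : tx ^ 2 + ty ^ 2 = 1) (hc : sx * tx + sy * ty = cos α) :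
    ∠ a b c = α := by
  unfold EuclideanGeometry.angle
  have e1 : a -ᵥ b = s • (!₂[-sx, -sy] : Pt) := by
    ext i; fin_cases i
    · simp; linarith
    · simp; linarith
  have e2 : c -ᵥ b = t • (!₂[-tx, -ty] : Pt) := by
    ext i; fin_cases i
    · simp; linarith
    · simp; linarith
  rw [e1, e2, InnerProductGeometry.angle_smul_left_of_pos _ _ hs,
    InnerProductGeometry.angle_smul_right_of_pos _ _ ht]
  unfold InnerProductGeometry.angle
  have n1 : ‖(!₂[-sx, -sy] : Pt)‖ = 1 := by
    rw [EuclideanSpace.norm_eq]; simp [ns]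
  have n2 : ‖(!₂[-tx, -ty] : Pt)‖ = 1 := by
    rw [EuclideanSpace.norm_eq]; simp [nt]
  have i1 : inner ℝ (!₂[-sx, -sy] : Pt) (!₂[-tx, -ty] : Pt) = cos α := by
    rw [← hc]
    simp [PiLp.inner_apply]; ring
  rw [n1, n2, i1]
  simp only [mul_one, div_one]
  exact Real.arccos_cos hα.1.le (by linarith [hα.2, Real.pi_pos])

/-- Properties of an arm from apex `A` to `q` bending at `b`, with tilt `κ`. -/
structure Arm (α δ σ τ κ : ℝ) (A q b : Pt) : Prop where
  ang : ∠ A b q = α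
  img : ∀ p ∈ bendImage (A, b, q),
    (∃ l : ℝ, 0 ≤ l ∧ σ * (p 0 - A 0) = l * sin (α - κ) ∧ τ * (p 1 - A 1) = l * cos (α - κ) ∧
      σ * (p 0 - q 0) < 0) ∨
    (∃ m : ℝ, 0 ≤ m ∧ σ * (p 0 - q 0) = - (m * sin κ) ∧ τ * (p 1 - q 1) = m * cos κ ∧
      m * sin κ < δ ∧ 0 ≤ σ * (p 0 - A 0) * cos (α - κ) - τ * (p 1 - A 1) * sin (α - κ))

lemma arm_exists {α δ σ τ : ℝ} (hα : α ∈ Set.Ioc 0 (π/2)) (hδ : 0 < δ) (hσ : σ * σ = 1)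
    (hτ : τ * τ = 1) {A q : Pt} (hX : 0 < σ * (q 0 - A 0)) (hY : 0 < τ * (A 1 - q 1)) :
    ∀ᶠ κ in 𝓝[>] (0:ℝ), ∃ b, Arm α δ σ τ κ A q b := by
  obtain ⟨hα0, hα1⟩ := hα
  have hsin : 0 < sin α := sin_pos_of_pos_of_lt_pi hα0 (by linarith [pi_pos])
  set X := σ * (q 0 - A 0) with hXd
  set Y := τ * (A 1 - q 1) with hYd
  have c1 : ∀ᶠ κ in 𝓝[>] (0:ℝ), 0 < X * cos κ - Y * sin κ := by
    have : ContinuousAt (fun κ : ℝ => X * cos κ - Y * sin κ) 0 := by fun_prop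
    exact (this.eventually (lt_mem_nhds (by simpa using hX))).filter_mono nhdsWithin_le_nhds
  have c2 : ∀ᶠ κ in 𝓝[>] (0:ℝ), (X * cos (α - κ) + Y * sin (α - κ)) / sin α * sin κ < min δ X := by
    have : ContinuousAt (fun κ : ℝ => (X * cos (α - κ) + Y * sin (α - κ)) / sin α * sin κ) 0 := by
      fun_prop
    exact (this.eventually (gt_mem_nhds (by simpa using ⟨hδ, hX⟩))).filter_mono nhdsWithin_le_nhds
  have c3 : ∀ᶠ κ in 𝓝[>] (0:ℝ), κ ∈ Set.Ioo 0 α := Ioo_mem_nhdsGT hα0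
  filter_upwards [c1, c2, c3] with κ k1 k2 k3
  obtain ⟨k3, k4⟩ := k3
  set s := (X * cos κ - Y * sin κ) / sin α with hs
  set t := (X * cos (α - κ) + Y * sin (α - κ)) / sin α with ht
  have hθs : 0 < sin (α - κ) := sin_pos_of_pos_of_lt_pi (by linarith) (by linarith [pi_pos])
  have hθc : 0 < cos (α - κ) := cos_pos_of_mem_Ioo ⟨by linarith [pi_pos], by linarith⟩
  have hκs : 0 < sin κ := sin_pos_of_pos_of_lt_pi k3 (by linarith [pi_pos])
  have hs0 : 0 < s := div_pos k1 hsin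
  have ht0 : 0 < t := div_pos (by positivity) hsin
  have hsa : sin α = sin (α - κ) * cos κ + cos (α - κ) * sin κ := by
    rw [← sin_add]; ring_nf
  have hca : cos α = cos (α - κ) * cos κ - sin (α - κ) * sin κ := by
    rw [← cos_add]; ring_nf
  have sq1 := sin_sq_add_cos_sq (α - κ)
  have sq2 := sin_sq_add_cos_sq κ
  have eX : s * sin (α - κ) = X - t * sin κ := by
    rw [hs, ht]; field_simp; rw [hsa]; ring
  have eY : s * cos (α - κ) = -Y + t * cos κ := by
    rw [hs, ht]; field_simp; rw [hsa]; ring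
  set b : Pt := !₂[A 0 + σ * (s * sin (α - κ)), A 1 + τ * (s * cos (α - κ))] with hb
  have b0 : b 0 = A 0 + σ * (s * sin (α - κ)) := by simp [hb]
  have b1 : b 1 = A 1 + τ * (s * cos (α - κ)) := by simp [hb]
  have b0' : b 0 - q 0 = - (σ * (t * sin κ)) := by
    rw [b0, eX, hXd]; linear_combination (q 0 - A 0) * hσ
  have b1' : b 1 - q 1 = τ * (t * cos κ) := by
    rw [b1, eY, hYd]; linear_combination (q 1 - A 1) * hτ
  have k2a := lt_of_lt_of_le k2 (min_le_left _ _)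
  have k2b := lt_of_lt_of_le k2 (min_le_right _ _)
  refine ⟨b, ?_, ?_⟩
  · refine angle_of_coords ⟨hα0, hα1⟩ hs0 ht0 (sx := σ * sin (α - κ)) (sy := τ * cos (α - κ))
      (tx := - (σ * sin κ)) (ty := τ * cos κ) (by rw [b0]; ring) (by rw [b1]; ring)
      (by rw [b0']; ring) (by rw [b1']; ring) ?_ ?_ ?_
    · linear_combination sin (α - κ) ^ 2 * hσ + cos (α - κ) ^ 2 * hτ + sq1
    · linear_combination sin κ ^ 2 * hσ + cos κ ^ 2 * hτ + sq2
    · rw [hca]; linear_combination - sin (α - κ) * sin κ * hσ + cos (α - κ) * cos κ * hτ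
  · intro p hp
    rcases bend_coords hp with ⟨r, r0, r1, p0, p1⟩ | ⟨r, r0, r1, p0, p1⟩
    · left
      refine ⟨r * s, by positivity, ?_, ?_, ?_⟩
      · rw [p0, b0]; linear_combination r * s * sin (α - κ) * hσ
      · rw [p1, b1]; linear_combination r * s * cos (α - κ) * hτ
      · have e : σ * (p 0 - q 0) = r * (s * sin (α - κ)) - X := by
          rw [p0, b0, hXd]; linear_combination r * s * sin (α - κ) * hσ
        rw [e]
        have : r * (s * sin (α - κ)) ≤ 1 * (s * sin (α - κ)) :=
          mul_le_mul_of_nonneg_right r1 (by positivity)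
        have : 0 < t * sin κ := by positivity
        linarith
    · right
      refine ⟨r * t, by positivity, ?_, ?_, ?_, ?_⟩
      · rw [p0, b0']; linear_combination - r * t * sin κ * hσ
      · rw [p1, b1']; linear_combination r * t * cos κ * hτ
      · have : r * (t * sin κ) ≤ 1 * (t * sin κ) := mul_le_mul_of_nonneg_right r1 (by positivity)
        linarith
      · have e : σ * (p 0 - A 0) * cos (α - κ) - τ * (p 1 - A 1) * sin (α - κ) =
            (1 - r) * (X * cos (α - κ) + Y * sin (α - κ)) := by
          have e0 : σ * (p 0 - A 0) = X - r * (t * sin κ) := by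
            rw [p0, b0', hXd]; linear_combination - r * t * sin κ * hσ
          have e1 : τ * (p 1 - A 1) = -Y + r * (t * cos κ) := by
            rw [p1, b1', hYd]; linear_combination r * t * cos κ * hτ
          rw [e0, e1]
          have : t * sin α = X * cos (α - κ) + Y * sin (α - κ) := by rw [ht]; field_simp
          rw [hsa] at this
          linear_combination -r * this
        rw [e]
        exact mul_nonneg (by linarith) (by positivity)


lemma pt_ext {p q : Pt} (h0 : p 0 = q 0) (h1 : p 1 = q 1) : p = q := by
  ext i; fin_cases i
  · exact h0
  · exact h1

lemma polar {X Y : ℝ} (hX : 0 < X) : ∃ ρ S : ℝ, 0 < ρ ∧ 0 < S ∧ S < π ∧ X = ρ * sin S ∧ Y = ρ * cos S := by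
  set z : ℂ := ⟨Y, X⟩
  have hz : z ≠ 0 := fun h => by
    have := congrArg Complex.im h
    simp only [z, Complex.zero_im] at this
    linarith
  have h1 : X = ‖z‖ * sin z.arg := (Complex.norm_mul_sin_arg z).symm
  have h2 : Y = ‖z‖ * cos z.arg := (Complex.norm_mul_cos_arg z).symm
  have hn : 0 < ‖z‖ := norm_pos_iff.2 hz
  have hs : 0 < sin z.arg := by
    by_contra hcon
    have := mul_nonneg hn.le (neg_nonneg.2 (not_lt.1 hcon))
    linarith
  have h0 : 0 < z.arg := by
    by_contra hcon
    have := sin_nonpos_of_nonpos_of_neg_pi_le (not_lt.1 hcon) (Complex.neg_pi_lt_arg z).le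
    linarith
  have hpi : z.arg < π := lt_of_le_of_ne (Complex.arg_le_pi z) (fun h => by
    rw [h, sin_pi] at hs; exact lt_irrefl _ hs)
  exact ⟨‖z‖, z.arg, hn, h0, hpi, h1, h2⟩

/-- Properties of the bend `b` of a path edge from `q` to the outer neighbour of it. -/
structure RB (α σ : ℝ) (w q b q' : Pt) : Prop where
  ang : ∠ q b q' = α
  l : 0 < σ * (b 0 - q 0)
  r : 0 < σ * (q' 0 - b 0)
  above : 0 < (b 1 - q 1) * (σ * (q' 0 - q 0)) - (q' 1 - q 1) * (σ * (b 0 - q 0))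
  below : 0 < σ * (b 0 - w 0) * cos α - (b 1 - w 1) * sin α

lemma rb_exists {α σ : ℝ} (hα : α ∈ Set.Ioc 0 (π/2)) (hσ : σ * σ = 1) {w q q' : Pt}
    (hqq : 0 < σ * (q' 0 - q 0)) (hq : 0 < σ * (q 0 - w 0)) (hq1 : q 1 < w 1) (hq1' : q' 1 < w 1) :
    ∃ b, RB α σ w q b q' := by
  obtain ⟨hα0, hα1⟩ := hα
  have hpi := pi_pos
  have hsin : 0 < sin α := sin_pos_of_pos_of_lt_pi hα0 (by linarith)
  have hcos : 0 ≤ cos α := cos_nonneg_of_mem_Icc ⟨by linarith, by linarith⟩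
  obtain ⟨ρ, S, hρ, hS0, hSpi, hX, hY⟩ := polar (Y := q' 1 - q 1) hqq
  set μ := min α S with hμ
  have hμ0 : 0 < μ := lt_min hα0 hS0
  have hμα : μ ≤ α := min_le_left _ _
  have hμS : μ ≤ S := min_le_right _ _
  have Nq : 0 < σ * (q 0 - w 0) * cos α - (q 1 - w 1) * sin α := by
    have : 0 ≤ σ * (q 0 - w 0) * cos α := mul_nonneg hq.le hcos
    nlinarith
  have Nq' : 0 < σ * (q' 0 - w 0) * cos α - (q' 1 - w 1) * sin α := by
    have : 0 ≤ σ * (q' 0 - w 0) * cos α := mul_nonneg (by linarith) hcos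
    nlinarith
  have hSμ : S - μ + α < π := by
    rcases le_total α S with h | h
    · rw [hμ, min_eq_left h]; linarith
    · rw [hμ, min_eq_right h]; linarith
  have c1 : ∀ᶠ η in 𝓝[>] (0:ℝ), 0 < σ * (q 0 - w 0) * cos α - (q 1 - w 1) * sin α +
      ρ * sin (S - (μ - η - α)) / sin α * sin (μ - η - α) := by
    have hc : ContinuousAt (fun η : ℝ => σ * (q 0 - w 0) * cos α - (q 1 - w 1) * sin α +
      ρ * sin (S - (μ - η - α)) / sin α * sin (μ - η - α)) 0 := by fun_prop
    refine (hc.eventually (lt_mem_nhds ?_)).filter_mono nhdsWithin_le_nhds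
    simp only [sub_zero]
    rcases le_total α S with h | h
    · rw [hμ, min_eq_left h]; simpa using Nq
    · rw [hμ, min_eq_right h]
      have e : S - (S - α) = α := by ring
      rw [e, mul_div_assoc, div_self hsin.ne', mul_one, sin_sub]
      have : ρ * (sin S * cos α - cos S * sin α) = σ * (q' 0 - q 0) * cos α - (q' 1 - q 1) * sin α := by
        rw [hX, hY]; ring
      rw [this]; linarith
  have c2 : ∀ᶠ η in 𝓝[>] (0:ℝ), η ∈ Set.Ioo 0 (min μ (π - (S - μ + α))) :=
    Ioo_mem_nhdsGT (lt_min hμ0 (by linarith))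
  obtain ⟨η, k1, k2, k3⟩ := (c1.and c2).exists
  have k4 := lt_of_lt_of_le k3 (min_le_left _ _)
  have k5 := lt_of_lt_of_le k3 (min_le_right _ _)
  set θ := μ - η with hθ
  set s := ρ * sin (S - (θ - α)) / sin α with hs
  set t := ρ * sin (S - θ) / sin α with ht
  have s0 : 0 < s := div_pos (mul_pos hρ (sin_pos_of_pos_of_lt_pi (by linarith) (by linarith))) hsin
  have hSθ : 0 < sin (S - θ) := sin_pos_of_pos_of_lt_pi (by linarith) (by linarith)
  have t0 : 0 < t := div_pos (mul_pos hρ hSθ) hsin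
  have hsθ : 0 < sin θ := sin_pos_of_pos_of_lt_pi (by linarith) (by linarith)
  have hsφ : sin (θ - α) < 0 := sin_neg_of_neg_of_neg_pi_lt (by linarith) (by linarith)
  have hsa : sin α = sin θ * cos (θ - α) - cos θ * sin (θ - α) := by rw [← sin_sub]; ring_nf
  have hca : cos α = cos θ * cos (θ - α) + sin θ * sin (θ - α) := by rw [← cos_sub]; ring_nf
  have e1 : s * sin θ = ρ * sin S + t * sin (θ - α) := by
    have h1 := sin_sub S (θ - α)
    have h2 := sin_sub S θ
    rw [hs, ht, h1, h2]; field_simp; rw [hsa]; ring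
  have e2 : s * cos θ = ρ * cos S + t * cos (θ - α) := by
    have h1 := sin_sub S (θ - α)
    have h2 := sin_sub S θ
    rw [hs, ht, h1, h2]; field_simp; rw [hsa]; ring
  set b : Pt := !₂[q 0 + σ * (s * sin θ), q 1 + s * cos θ] with hb
  have b0 : b 0 = q 0 + σ * (s * sin θ) := by simp [hb]
  have b1 : b 1 = q 1 + s * cos θ := by simp [hb]
  have b0' : b 0 - q' 0 = σ * (t * sin (θ - α)) := by
    rw [b0, e1, ← hX]; linear_combination (q' 0 - q 0) * hσ
  have b1' : b 1 - q' 1 = t * cos (θ - α) := by rw [b1, e2, ← hY]; ring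
  have b0n : σ * (b 0 - q 0) = s * sin θ := by rw [b0]; linear_combination s * sin θ * hσ
  refine ⟨b, ?_, ?_, ?_, ?_, ?_⟩
  · refine angle_of_coords ⟨hα0, hα1⟩ s0 t0 (sx := σ * sin θ) (sy := cos θ)
      (tx := σ * sin (θ - α)) (ty := cos (θ - α)) (by rw [b0]; ring) (by rw [b1]; ring)
      (by rw [b0']; ring) (by rw [b1']) ?_ ?_ ?_
    · linear_combination sin θ ^ 2 * hσ + sin_sq_add_cos_sq θ
    · linear_combination sin (θ - α) ^ 2 * hσ + sin_sq_add_cos_sq (θ - α)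
    · rw [hca]; linear_combination sin θ * sin (θ - α) * hσ
  · rw [b0n]; positivity
  · have : σ * (q' 0 - b 0) = t * (- sin (θ - α)) := by
      linear_combination -σ * b0' - t * sin (θ - α) * hσ
    rw [this]; exact mul_pos t0 (by linarith)
  · rw [b0n, hX, hY, b1]
    have : (q 1 + s * cos θ - q 1) * (ρ * sin S) - ρ * cos S * (s * sin θ) = s * ρ * sin (S - θ) := by
      have h := sin_sub S θ
      rw [h]; ring
    rw [this]; positivity
  · have : σ * (b 0 - w 0) * cos α - (b 1 - w 1) * sin α =
      σ * (q 0 - w 0) * cos α - (q 1 - w 1) * sin α + s * sin (θ - α) := by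
      have h := sin_sub θ α
      rw [h, b1]; linear_combination b0n * cos α
    rw [this]; exact k1

lemma conv_lb {l δ K : ℝ} (h0 : 0 ≤ l) (h1 : l ≤ 1) (hδ : 0 < δ) (hK : -δ < K) : -δ < l * K := by
  rcases le_total 0 K with h | h
  · have := mul_nonneg h0 h; linarith
  · have := mul_nonneg (sub_nonneg.2 h1) (neg_nonneg.2 h); linarith

lemma conv_pos {l A B : ℝ} (h0 : 0 ≤ l) (h1 : l ≤ 1) (hA : 0 < A) (hB : 0 < B) :
    0 < l * A + (1 - l) * B := by
  rcases eq_or_lt_of_le h0 with h | h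
  · rw [← h]; linarith
  · have h2 := mul_pos h hA
    have h3 := mul_nonneg (sub_nonneg.2 h1) hB.le
    linarith

/-- Properties of the bend of the edge `vw`. -/
structure VWB (α δ σ : ℝ) (v b w : Pt) : Prop where
  ang : ∠ v b w = α
  img : ∀ p ∈ bendImage (v, b, w), -δ < σ * (p 0 - v 0) ∧ σ * (p 0 - w 0) ≤ 0 ∧
    (p 1 < w 1 ∨ p = w) ∧ (0 < sin α * (p 1 - v 1) - cos α * (σ * (p 0 - v 0)) ∨ p = v)

lemma vwb_exists {α δ σ : ℝ} (hα : α ∈ Set.Ioc 0 (π/2)) (hδ : 0 < δ) (hσ : σ * σ = 1) {v w : Pt}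
    (hX : 0 < σ * (w 0 - v 0)) (hH : v 1 < w 1)
    (hst : σ * (w 0 - v 0) * cos α < sin α * (w 1 - v 1)) :
    ∃ b, VWB α δ σ v b w := by
  obtain ⟨hα0, hα1⟩ := hα
  have hpi := pi_pos
  have hsin : 0 < sin α := sin_pos_of_pos_of_lt_pi hα0 (by linarith)
  obtain ⟨ρ, S, hρ, hS0, hSpi, hXp, hY⟩ := polar (Y := w 1 - v 1) hX
  have hcS : 0 < cos S := by
    by_contra hcon
    have := mul_nonneg hρ.le (neg_nonneg.2 (not_lt.1 hcon))
    linarith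
  have hsS : 0 < sin S := sin_pos_of_pos_of_lt_pi hS0 hSpi
  have c1 : ∀ᶠ β in 𝓝[>] (0:ℝ), -δ < - (ρ * sin β / sin α) * sin (S + β + α) := by
    have : ContinuousAt (fun β : ℝ => - (ρ * sin β / sin α) * sin (S + β + α)) 0 := by fun_prop
    exact (this.eventually (lt_mem_nhds (by simpa using hδ))).filter_mono nhdsWithin_le_nhds
  have c2 : ∀ᶠ β in 𝓝[>] (0:ℝ), 0 < cos (S + β) := by
    have : ContinuousAt (fun β : ℝ => cos (S + β)) 0 := by fun_prop
    exact (this.eventually (lt_mem_nhds (by simpa using hcS))).filter_mono nhdsWithin_le_nhds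
  have c3 : ∀ᶠ β in 𝓝[>] (0:ℝ), 0 < sin (S + β) := by
    have : ContinuousAt (fun β : ℝ => sin (S + β)) 0 := by fun_prop
    exact (this.eventually (lt_mem_nhds (by simpa using hsS))).filter_mono nhdsWithin_le_nhds
  have c4 : ∀ᶠ β in 𝓝[>] (0:ℝ), 0 < sin (α + β) := by
    have : ContinuousAt (fun β : ℝ => sin (α + β)) 0 := by fun_prop
    exact (this.eventually (lt_mem_nhds (by simpa using hsin))).filter_mono nhdsWithin_le_nhds
  have c5 : ∀ᶠ β in 𝓝[>] (0:ℝ), β ∈ Set.Ioo 0 π := Ioo_mem_nhdsGT hpi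
  obtain ⟨β, k1, k2, k3, k4, k5, k6⟩ := (c1.and (c2.and (c3.and (c4.and c5)))).exists
  have hsβ : 0 < sin β := sin_pos_of_pos_of_lt_pi k5 k6
  set u := S + β with hu
  set t := ρ * sin β / sin α with ht
  set r := ρ * sin (α + β) / sin α with hr
  have t0 : 0 < t := div_pos (mul_pos hρ hsβ) hsin
  have r0 : 0 < r := div_pos (mul_pos hρ k4) hsin
  have hSu : S = u - β := by rw [hu]; ring
  have e1 : ρ * sin S = - t * sin (u + α) + r * sin u := by
    rw [ht, hr, hSu, sin_sub, sin_add u α, sin_add α β]; field_simp; ring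
  have e2 : ρ * cos S = - t * cos (u + α) + r * cos u := by
    rw [ht, hr, hSu, cos_sub, cos_add u α, sin_add α β]; field_simp; ring
  set b : Pt := !₂[v 0 + σ * (- t * sin (u + α)), v 1 + (- t * cos (u + α))] with hb
  have b0 : b 0 = v 0 + σ * (- t * sin (u + α)) := by simp [hb]
  have b1 : b 1 = v 1 + (- t * cos (u + α)) := by simp [hb]
  have b0' : b 0 - w 0 = σ * (- r * sin u) := by
    rw [b0]; linear_combination -σ * e1 - σ * hXp + (w 0 - v 0) * hσ
  have b1' : b 1 - w 1 = - r * cos u := by rw [b1]; linear_combination -e2 - hY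
  refine ⟨b, ?_, ?_⟩
  · refine angle_of_coords ⟨hα0, hα1⟩ t0 r0 (sx := - (σ * sin (u + α))) (sy := - cos (u + α))
      (tx := -(σ * sin u)) (ty := - cos u) (by rw [b0]; ring) (by rw [b1]; ring)
      (by rw [b0']; ring) (by rw [b1']; ring) ?_ ?_ ?_
    · linear_combination sin (u + α) ^ 2 * hσ + sin_sq_add_cos_sq (u + α)
    · linear_combination sin u ^ 2 * hσ + sin_sq_add_cos_sq u
    · have : cos α = cos (u + α) * cos u + sin (u + α) * sin u := by rw [← cos_sub]; ring_nf
      rw [this]; linear_combination sin (u + α) * sin u * hσ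
  · have fb : sin α * (- t * cos (u + α)) - cos α * (- t * sin (u + α)) = t * sin u := by
      have : sin u = sin (u + α) * cos α - cos (u + α) * sin α := by rw [← sin_sub]; ring_nf
      rw [this]; ring
    have bx : σ * (b 0 - v 0) = - t * sin (u + α) := by
      rw [b0]; linear_combination (- t * sin (u + α)) * hσ
    have bx' : σ * (b 0 - w 0) = - r * sin u := by
      rw [b0']; linear_combination (- r * sin u) * hσ
    have hru : 0 < r * sin u := mul_pos r0 k3
    have hrc : 0 < r * cos u := mul_pos r0 k2
    have htu : 0 < t * sin u := mul_pos t0 k3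
    intro p hp
    rcases bend_coords hp with ⟨l, l0, l1, p0, p1⟩ | ⟨l, l0, l1, p0, p1⟩
    · have q0 : σ * (p 0 - v 0) = l * (- t * sin (u + α)) := by
        rw [p0]; linear_combination l * bx
      have q0' : σ * (p 0 - w 0) = l * (- r * sin u) - (1 - l) * (σ * (w 0 - v 0)) := by
        rw [p0]; linear_combination l * bx'
      have q1 : p 1 - v 1 = l * (- t * cos (u + α)) := by rw [p1, b1]; ring
      have q1' : w 1 - p 1 = l * (r * cos u) + (1 - l) * (w 1 - v 1) := by
        linear_combination -p1 - l * b1'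
      refine ⟨?_, ?_, ?_, ?_⟩
      · rw [q0]
        exact conv_lb l0 l1 hδ (by linarith)
      · rw [q0']
        have h1 := mul_nonneg l0 hru.le
        have h2 := mul_nonneg (sub_nonneg.2 l1) hX.le
        linarith
      · left
        have := conv_pos l0 l1 hrc (sub_pos.2 hH)
        linarith
      · rcases eq_or_lt_of_le l0 with h | h
        · right
          rw [← h] at p0 p1
          exact pt_ext (by simpa using p0) (by simpa using p1)
        · left
          rw [q0, q1]
          have : sin α * (l * (-t * cos (u + α))) - cos α * (l * (-t * sin (u + α))) = l * (t * sin u) := by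
            rw [← fb]; ring
          rw [this]; positivity
    · have q0 : σ * (p 0 - v 0) = l * (- t * sin (u + α)) + (1 - l) * (σ * (w 0 - v 0)) := by
        rw [p0]; linear_combination l * bx
      have q0' : σ * (p 0 - w 0) = l * (- r * sin u) := by
        rw [p0]; linear_combination l * bx'
      have q1 : p 1 - v 1 = l * (- t * cos (u + α)) + (1 - l) * (w 1 - v 1) := by rw [p1, b1]; ring
      have q1' : w 1 - p 1 = l * (r * cos u) := by
        linear_combination -p1 - l * b1'
      refine ⟨?_, ?_, ?_, ?_⟩
      · rw [q0]
        have h1 := mul_nonneg (sub_nonneg.2 l1) hX.le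
        have h2 : -δ < l * (- t * sin (u + α)) := conv_lb l0 l1 hδ (by linarith)
        linarith
      · rw [q0']
        have h1 := mul_nonneg l0 hru.le
        linarith
      · rcases eq_or_lt_of_le l0 with h | h
        · right
          rw [← h] at p0 p1
          exact pt_ext (by simpa using p0) (by simpa using p1)
        · left
          have h1 := mul_pos h hrc
          linarith
      · left
        rw [q0, q1]
        have : sin α * (l * (-t * cos (u + α)) + (1 - l) * (w 1 - v 1)) -
            cos α * (l * (-t * sin (u + α)) + (1 - l) * (σ * (w 0 - v 0))) =
            l * (t * sin u) + (1 - l) * (sin α * (w 1 - v 1) - σ * (w 0 - v 0) * cos α) := by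
          rw [← fb]; ring
        rw [this]
        exact conv_pos l0 l1 htu (by linarith)


/-- The tilt range. -/
structure TiltOK (α κ : ℝ) : Prop where
  pos : 0 < κ
  lt : κ < α
  le : α ≤ π / 2

lemma TiltOK.sk {α κ : ℝ} (h : TiltOK α κ) : 0 < sin κ :=
  sin_pos_of_pos_of_lt_pi h.pos (by linarith [h.lt, h.le, pi_pos])
lemma TiltOK.ck {α κ : ℝ} (h : TiltOK α κ) : 0 < cos κ :=
  cos_pos_of_mem_Ioo ⟨by linarith [h.pos, pi_pos], by linarith [h.lt, h.le]⟩
lemma TiltOK.st {α κ : ℝ} (h : TiltOK α κ) : 0 < sin (α - κ) :=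
  sin_pos_of_pos_of_lt_pi (by linarith [h.lt]) (by linarith [h.pos, h.le, pi_pos])
lemma TiltOK.ct {α κ : ℝ} (h : TiltOK α κ) : 0 < cos (α - κ) :=
  cos_pos_of_mem_Ioo ⟨by linarith [h.lt, pi_pos], by linarith [h.pos, h.le]⟩

lemma eq_of_scaled {σ τ : ℝ} (hσ : σ * σ = 1) (hτ : τ * τ = 1) {p A : Pt}
    (h0 : σ * (p 0 - A 0) = 0) (h1 : τ * (p 1 - A 1) = 0) : p = A := by
  refine pt_ext ?_ ?_
  · linear_combination σ * h0 - (p 0 - A 0) * hσ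
  · linear_combination τ * h1 - (p 1 - A 1) * hτ

lemma Arm.loc {α δ σ τ κ : ℝ} {A q b p : Pt} (h : Arm α δ σ τ κ A q b) (hσ : σ * σ = 1)
    (hτ : τ * τ = 1) (hκ : TiltOK α κ) (hp : p ∈ bendImage (A, b, q)) :
    p = A ∨ (0 < τ * (p 1 - A 1) ∧ 0 < σ * (p 0 - A 0) ∧ σ * (p 0 - q 0) < 0) ∨
    p = q ∨ (-δ < σ * (p 0 - q 0) ∧ σ * (p 0 - q 0) < 0 ∧ 0 < τ * (p 1 - q 1)) := by
  rcases h.img p hp with ⟨l, l0, e0, e1, h2⟩ | ⟨m, m0, e0, e1, h2, -⟩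
  · rcases eq_or_lt_of_le l0 with h | h
    · left
      rw [← h, zero_mul] at e0 e1
      exact eq_of_scaled hσ hτ e0 e1
    · right; left
      exact ⟨by rw [e1]; exact mul_pos h hκ.ct, by rw [e0]; exact mul_pos h hκ.st, h2⟩
  · right; right
    rcases eq_or_lt_of_le m0 with h | h
    · left
      rw [← h, zero_mul] at e0 e1
      exact eq_of_scaled hσ hτ (by linarith) e1
    · right
      have := mul_pos h hκ.sk
      exact ⟨by linarith, by linarith, by rw [e1]; exact mul_pos h hκ.ck⟩

lemma Arm.side {α δ σ τ κ : ℝ} {A q b p : Pt} (h : Arm α δ σ τ κ A q b) (hσ : σ * σ = 1)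
    (hτ : τ * τ = 1) (hκ : TiltOK α κ) (hδ : 0 < δ) (hq : 2 * δ < σ * (q 0 - A 0))
    (hp : p ∈ bendImage (A, b, q)) : p = A ∨ 0 < σ * (p 0 - A 0) := by
  rcases h.loc hσ hτ hκ hp with h | h | h | h
  · exact Or.inl h
  · exact Or.inr h.2.1
  · right; rw [h]; linarith
  · right; linarith [h.1]

lemma arm_arm_same {α δ σ τ κ κ' : ℝ} {A q b q' b' p : Pt} (h : Arm α δ σ τ κ A q b)
    (h' : Arm α δ σ τ κ' A q' b') (hσ : σ * σ = 1)
    (hτ : τ * τ = 1) (hκ : TiltOK α κ) (hκ' : TiltOK α κ') (hlt : κ < κ') (hδ : 0 < δ)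
    (hqq : 2 * δ < σ * (q' 0 - q 0))
    (hp : p ∈ bendImage (A, b, q)) (hp' : p ∈ bendImage (A, b', q')) : p = A := by
  have hs : 0 < sin (κ' - κ) :=
    sin_pos_of_pos_of_lt_pi (by linarith) (by linarith [hκ.pos, hκ'.lt, hκ.le, pi_pos])
  have hsd : sin (κ' - κ) = sin (α - κ) * cos (α - κ') - cos (α - κ) * sin (α - κ') := by
    rw [← sin_sub]; ring_nf
  rcases h'.img p hp' with ⟨l', l0', e0', e1', h2'⟩ | ⟨m', m0', e0', e1', h2', -⟩
  · have key : l' * sin (κ' - κ) ≤ 0 := by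
      rcases h.img p hp with ⟨l, l0, e0, e1, h2⟩ | ⟨m, m0, e0, e1, h2, h3⟩
      · rw [hsd]
        have : l' * (sin (α - κ) * cos (α - κ') - cos (α - κ) * sin (α - κ')) = 0 := by
          linear_combination - sin (α - κ) * (e1' - e1) + cos (α - κ) * (e0' - e0)
        exact this.le
      · rw [hsd]
        rw [e0', e1'] at h3
        linarith
    have : l' = 0 := by
      by_contra hne
      have := mul_pos (lt_of_le_of_ne l0' (Ne.symm hne)) hs
      linarith
    rw [this, zero_mul] at e0' e1'
    exact eq_of_scaled hσ hτ e0' e1'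
  · exfalso
    have hle : σ * (p 0 - q 0) ≤ 0 := by
      rcases h.img p hp with ⟨l, l0, e0, e1, h2⟩ | ⟨m, m0, e0, e1, h2, h3⟩
      · exact h2.le
      · have := mul_nonneg m0 hκ.sk.le
        linarith
    linarith

lemma arm_arm_opp {α δ σ τ κ κ' : ℝ} {A q b q' b' p : Pt} (h : Arm α δ σ τ κ A q b)
    (h' : Arm α δ (-σ) τ κ' A q' b') (hσ : σ * σ = 1)
    (hτ : τ * τ = 1) (hκ : TiltOK α κ) (hκ' : TiltOK α κ') (hδ : 0 < δ)
    (hq : 2 * δ < σ * (q 0 - A 0)) (hq' : 2 * δ < -σ * (q' 0 - A 0))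
    (hp : p ∈ bendImage (A, b, q)) (hp' : p ∈ bendImage (A, b', q')) : p = A := by
  rcases h.side hσ hτ hκ hδ hq hp with h1 | h1
  · exact h1
  rcases h'.side (by linarith) hτ hκ' hδ hq' hp' with h2 | h2
  · exact h2
  linarith

lemma RB.loc {α σ : ℝ} {w q b q' p : Pt} (h : RB α σ w q b q') (hσ : σ * σ = 1)
    (hp : p ∈ bendImage (q, b, q')) :
    (p = q ∨ p = q' ∨ (0 < σ * (p 0 - q 0) ∧ 0 < σ * (q' 0 - p 0))) ∧
    0 ≤ (p 1 - q 1) * (σ * (q' 0 - q 0)) - (q' 1 - q 1) * (σ * (p 0 - q 0)) := by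
  have hl := h.l
  have hr := h.r
  have ha := h.above
  rcases bend_coords hp with ⟨t, t0, t1, p0, p1⟩ | ⟨t, t0, t1, p0, p1⟩
  · constructor
    · rcases eq_or_lt_of_le t0 with h | h
      · left; rw [← h] at p0 p1
        exact pt_ext (by simpa using p0) (by simpa using p1)
      · right; right
        have e1 : σ * (p 0 - q 0) = t * (σ * (b 0 - q 0)) := by rw [p0]; ring
        have e2 : σ * (q' 0 - p 0) = t * (σ * (q' 0 - b 0)) + (1 - t) * (σ * (q' 0 - q 0)) := by
          rw [p0]; ring
        rw [e1, e2]
        exact ⟨mul_pos h hl, conv_pos t0 t1 hr (by linarith)⟩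
    · rw [p0, p1]
      have := mul_nonneg t0 ha.le
      linarith
  · constructor
    · rcases eq_or_lt_of_le t0 with h | h
      · right; left; rw [← h] at p0 p1
        exact pt_ext (by simpa using p0) (by simpa using p1)
      · right; right
        have e1 : σ * (q' 0 - p 0) = t * (σ * (q' 0 - b 0)) := by rw [p0]; ring
        have e2 : σ * (p 0 - q 0) = t * (σ * (b 0 - q 0)) + (1 - t) * (σ * (q' 0 - q 0)) := by
          rw [p0]; ring
        rw [e1, e2]
        exact ⟨conv_pos t0 t1 hl (by linarith), mul_pos h hr⟩
    · rw [p0, p1]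
      have := mul_nonneg t0 ha.le
      linarith

lemma RB.xle {α σ : ℝ} {w q b q' p : Pt} (h : RB α σ w q b q') (hσ : σ * σ = 1)
    (hp : p ∈ bendImage (q, b, q')) : 0 ≤ σ * (p 0 - q 0) ∧ 0 ≤ σ * (q' 0 - p 0) := by
  have hl := h.l
  have hr := h.r
  rcases (h.loc hσ hp).1 with h | h | h
  · rw [h]; constructor <;> linarith
  · rw [h]; constructor <;> linarith
  · exact ⟨h.1.le, h.2.le⟩

/-- positivity of an affine functional on the bend edge -/
lemma bend_pos {a b c p o : Pt} {A B : ℝ} (hp : p ∈ bendImage (a, b, c))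
    (ha : 0 < (a 0 - o 0) * A + (a 1 - o 1) * B) (hb : 0 < (b 0 - o 0) * A + (b 1 - o 1) * B)
    (hc : 0 < (c 0 - o 0) * A + (c 1 - o 1) * B) : 0 < (p 0 - o 0) * A + (p 1 - o 1) * B := by
  rcases bend_coords hp with ⟨t, t0, t1, p0, p1⟩ | ⟨t, t0, t1, p0, p1⟩
  · have := conv_pos t0 t1 hb ha
    rw [p0, p1]; linarith
  · have := conv_pos t0 t1 hb hc
    rw [p0, p1]; linarith

lemma bend_neg_or {a b c p : Pt} {A B : ℝ} (hp : p ∈ bendImage (a, b, c))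
    (ha : (a 0 - c 0) * A + (a 1 - c 1) * B < 0) (hb : (b 0 - c 0) * A + (b 1 - c 1) * B < 0) :
    p = c ∨ (p 0 - c 0) * A + (p 1 - c 1) * B < 0 := by
  rcases bend_coords hp with ⟨t, t0, t1, p0, p1⟩ | ⟨t, t0, t1, p0, p1⟩
  · right
    have := conv_pos t0 t1 (neg_pos.2 hb) (neg_pos.2 ha)
    rw [p0, p1]; linarith
  · rcases eq_or_lt_of_le t0 with h | h
    · left; rw [← h] at p0 p1
      exact pt_ext (by simpa using p0) (by simpa using p1)
    · right
      have := mul_pos h (neg_pos.2 hb)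
      rw [p0, p1]; linarith

lemma RB.ylow {α σ y : ℝ} {w q b q' p : Pt} (h : RB α σ w q b q') (hσ : σ * σ = 1)
    (hq : y < q 1) (hq' : y < q' 1) (hp : p ∈ bendImage (q, b, q')) : y < p 1 := by
  obtain ⟨h0, h1⟩ := h.xle hσ hp
  have hX : 0 < σ * (q' 0 - q 0) := by linarith [h.l, h.r]
  have h2 := (h.loc hσ hp).2
  by_contra hcon
  push Not at hcon
  set X := σ * (q' 0 - q 0)
  set x := σ * (p 0 - q 0)
  have hx : x ≤ X := by simp only [x, X]; linarith
  have k1 : (p 1 - q 1) * X < (y - q 1) * X + (q 1 - y) * X := by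
    have := mul_nonneg (sub_nonneg.2 hcon) hX.le
    have := mul_pos (sub_pos.2 hq) hX
    linarith
  -- (p1 - y) X ≥ (q1 - y)(X - x) + (q'1 - y) x
  have k2 : 0 ≤ (q 1 - y) * (X - x) := mul_nonneg (by linarith) (by linarith)
  have k3 : 0 ≤ (q' 1 - y) * x := mul_nonneg (by linarith) h0
  have k4 : 0 ≤ (y - p 1) * X := mul_nonneg (by linarith) hX.le
  have k5 : (q 1 - y) * (X - x) = 0 := by linarith
  have k6 : (q' 1 - y) * x = 0 := by linarith
  rcases mul_eq_zero.1 k5 with h | h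
  · linarith
  rcases mul_eq_zero.1 k6 with h' | h'
  · linarith
  linarith

lemma VWB.far {α δ σ σ0 : ℝ} {v b w p : Pt} (h : VWB α δ σ0 v b w) (hδ : 0 < δ)
    (hs : σ = σ0 ∨ σ = -σ0) (hp : p ∈ bendImage (v, b, w)) (h1 : δ ≤ σ * (p 0 - v 0))
    (h2 : 0 < σ * (p 0 - w 0)) : False := by
  obtain ⟨a1, a2, -, -⟩ := h.img p hp
  rcases hs with rfl | rfl
  · linarith
  · linarith

lemma VWB.armU {α δ σ σ0 κ : ℝ} {v b w p q b' : Pt} (h : VWB α δ σ0 v b w) (hδ : 0 < δ)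
    (hσ : σ * σ = 1) (hs : σ = σ0 ∨ σ = -σ0) (ha : Arm α δ σ 1 κ w q b') (hκ : TiltOK α κ)
    (hqv : 2 * δ < σ * (q 0 - v 0)) (hqw : 2 * δ < σ * (q 0 - w 0))
    (hp : p ∈ bendImage (v, b, w)) (hp' : p ∈ bendImage (w, b', q)) : p = w := by
  rcases ha.loc hσ (by norm_num) hκ hp' with k | ⟨k, -, -⟩ | k | ⟨k, -, -⟩
  · exact k
  · rcases (h.img p hp).2.2.1 with k' | k'
    · linarith
    · exact k'
  · exact (h.far hδ hs hp (by rw [k]; linarith) (by rw [k]; linarith)).elim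
  · exact (h.far hδ hs hp (by linarith) (by linarith)).elim

lemma VWB.armD {α δ σ σ0 κ : ℝ} {v b w p q b' : Pt} (h : VWB α δ σ0 v b w) (hδ : 0 < δ)
    (hσ : σ * σ = 1) (hs : σ = σ0 ∨ σ = -σ0) (ha : Arm α δ σ (-1) κ v q b') (hκ : TiltOK α κ)
    (hqv : 2 * δ < σ * (q 0 - v 0)) (hqw : 2 * δ < σ * (q 0 - w 0))
    (hp : p ∈ bendImage (v, b, w)) (hp' : p ∈ bendImage (v, b', q)) : p = v := by
  rcases ha.img p hp' with ⟨l, l0, e0, e1, h2⟩ | ⟨m, m0, e0, e1, h2, -⟩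
  · rcases (h.img p hp).2.2.2 with k | k
    · exfalso
      have e1' : p 1 - v 1 = - (l * cos (α - κ)) := by linarith
      rw [e1'] at k
      rcases hs with rfl | rfl
      · rw [e0] at k
        have : 0 ≤ l * sin (α + (α - κ)) := mul_nonneg l0
          (sin_nonneg_of_nonneg_of_le_pi (by linarith [hκ.pos, hκ.lt]) (by linarith [hκ.pos, hκ.le]))
        rw [sin_add] at this
        linarith
      · have e0' : σ0 * (p 0 - v 0) = - (l * sin (α - κ)) := by linarith
        rw [e0'] at k
        have : 0 ≤ l * sin (α - (α - κ)) := mul_nonneg l0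
          (by rw [sub_sub_cancel]; exact hκ.sk.le)
        rw [sin_sub α (α - κ)] at this
        linarith
    · exact k
  · exact (h.far hδ hs hp (by linarith) (by linarith)).elim


/-- Points other than `v`, `w`. -/
def IsQ (P : Finset Pt) (v w q : Pt) : Prop := q ∈ P ∧ q ≠ v ∧ q ≠ w

/-- All data of the construction. -/
structure Cfg (α δ σ0 : ℝ) (P : Finset Pt) (v w b0 : Pt) (sg kU kD : Pt → ℝ)
    (bU bD bR nxt : Pt → Pt) (IsR : Pt → Prop) : Prop where
  nf : NiceFrame α P v w
  hα0 : 0 < α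
  hα1 : α ≤ π / 2
  hδ : 0 < δ
  gap : ∀ p ∈ P, ∀ q ∈ P, p ≠ q → 2 * δ < |p 0 - q 0|
  hσ0 : σ0 = 1 ∨ σ0 = -1
  hsg : ∀ q, sg q = 1 ∨ sg q = -1
  sv : ∀ q, IsQ P v w q → 0 < sg q * (q 0 - v 0)
  sw : ∀ q, IsQ P v w q → 0 < sg q * (q 0 - w 0)
  tU : ∀ q, IsQ P v w q → TiltOK α (kU q)
  tD : ∀ q, IsQ P v w q → TiltOK α (kD q)
  mU : ∀ q q', IsQ P v w q → IsQ P v w q' → sg q = sg q' → 0 < sg q * (q' 0 - q 0) → kU q < kU q'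
  mD : ∀ q q', IsQ P v w q → IsQ P v w q' → sg q = sg q' → 0 < sg q * (q' 0 - q 0) → kD q < kD q'
  aU : ∀ q, IsQ P v w q → Arm α δ (sg q) 1 (kU q) w q (bU q)
  aD : ∀ q, IsQ P v w q → Arm α δ (sg q) (-1) (kD q) v q (bD q)
  rQ : ∀ q, IsR q → IsQ P v w q
  nQ : ∀ q, IsR q → IsQ P v w (nxt q)
  nsg : ∀ q, IsR q → sg (nxt q) = sg q
  nbt : ∀ q, IsR q → ∀ q', IsQ P v w q' → sg q' = sg q →
    sg q * (q' 0 - q 0) ≤ 0 ∨ 0 ≤ sg q * (q' 0 - nxt q 0)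
  rb : ∀ q, IsR q → RB α (sg q) w q (bR q) (nxt q)
  rU : ∀ q, IsR q → ∀ q', IsQ P v w q' → sg q' = sg q →
    0 < sg q * (bR q 0 - w 0) * cos (α - kU q') - (bR q 1 - w 1) * sin (α - kU q')
  rU2 : ∀ q, IsR q → sg q * (bR q 0 - nxt q 0) * cos (kU (nxt q)) +
    (bR q 1 - nxt q 1) * sin (kU (nxt q)) < 0
  rU3 : ∀ q, IsR q → sg q * (q 0 - nxt q 0) * cos (kU (nxt q)) +
    (q 1 - nxt q 1) * sin (kU (nxt q)) < 0
  rD : ∀ q, IsR q → - (cos (kD (nxt q)) * (sg q * (nxt q 0 - q 0))) +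
    sin (kD (nxt q)) * (nxt q 1 - q 1) < 0
  vw : VWB α δ σ0 v b0 w

namespace Cfg

variable {α δ σ0 : ℝ} {P : Finset Pt} {v w b0 : Pt} {sg kU kD : Pt → ℝ}
    {bU bD bR nxt : Pt → Pt} {IsR : Pt → Prop}

lemma sq (c : Cfg α δ σ0 P v w b0 sg kU kD bU bD bR nxt IsR) (q : Pt) : sg q * sg q = 1 := by
  rcases c.hsg q with h | h <;> rw [h] <;> norm_num

lemma gap' (c : Cfg α δ σ0 P v w b0 sg kU kD bU bD bR nxt IsR) {p q : Pt} (r : Pt) (hp : p ∈ P)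
    (hq : q ∈ P) (h : 0 < sg r * (p 0 - q 0)) : 2 * δ < sg r * (p 0 - q 0) := by
  have hne : p ≠ q := fun e => by rw [e, sub_self, mul_zero] at h; exact lt_irrefl _ h
  have := c.gap p hp q hq hne
  rcases c.hsg r with e | e <;> rw [e] at h ⊢
  · rw [abs_of_pos (by linarith)] at this; linarith
  · rw [abs_of_neg (by linarith)] at this; linarith

lemma eq_of_close (c : Cfg α δ σ0 P v w b0 sg kU kD bU bD bR nxt IsR) {p q : Pt} (hp : p ∈ P)
    (hq : q ∈ P) (h : |p 0 - q 0| ≤ 2 * δ) : p = q := by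
  by_contra hne
  have := c.gap p hp q hq hne
  linarith

lemma abs_lt (c : Cfg α δ σ0 P v w b0 sg kU kD bU bD bR nxt IsR) {p q : Pt} (r : Pt)
    (h : -δ < sg r * (p 0 - q 0)) (h' : sg r * (p 0 - q 0) ≤ 0) : |p 0 - q 0| < δ := by
  have hd := c.hδ
  rcases c.hsg r with e | e <;> rw [e] at h h' <;> rw [_root_.abs_lt] <;> constructor <;> linarith

lemma wsv (c : Cfg α δ σ0 P v w b0 sg kU kD bU bD bR nxt IsR) {q : Pt} (hq : IsQ P v w q) :
    2 * δ < sg q * (q 0 - v 0) := c.gap' q hq.1 c.nf.hv (c.sv q hq)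
lemma wsw (c : Cfg α δ σ0 P v w b0 sg kU kD bU bD bR nxt IsR) {q : Pt} (hq : IsQ P v w q) :
    2 * δ < sg q * (q 0 - w 0) := c.gap' q hq.1 c.nf.hw (c.sw q hq)
lemma my (c : Cfg α δ σ0 P v w b0 sg kU kD bU bD bR nxt IsR) {q : Pt} (hq : IsQ P v w q) :
    v 1 < q 1 ∧ q 1 < w 1 := c.nf.mid q hq.1 hq.2.1 hq.2.2
lemma opp (c : Cfg α δ σ0 P v w b0 sg kU kD bU bD bR nxt IsR) {q q' : Pt} (h : sg q ≠ sg q') :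
    sg q' = - sg q := by
  rcases c.hsg q with e | e <;> rcases c.hsg q' with e' | e'
  · exact absurd (e.trans e'.symm) h
  · rw [e, e']
  · rw [e, e']; norm_num
  · exact absurd (e.trans e'.symm) h
lemma s0 (c : Cfg α δ σ0 P v w b0 sg kU kD bU bD bR nxt IsR) (q : Pt) :
    sg q = σ0 ∨ sg q = -σ0 := by
  rcases c.hsg q with e | e <;> rcases c.hσ0 with e' | e' <;> rw [e, e'] <;> simp

lemma lt_or (c : Cfg α δ σ0 P v w b0 sg kU kD bU bD bR nxt IsR) {q q' : Pt} (r : Pt)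
    (hq : IsQ P v w q) (hq' : IsQ P v w q') (h : q ≠ q') :
    0 < sg r * (q' 0 - q 0) ∨ 0 < sg r * (q 0 - q' 0) := by
  have hne : q 0 ≠ q' 0 := fun e => h (c.nf.xinj q hq.1 q' hq'.1 e)
  rcases c.hsg r with e | e <;> rw [e] <;> rcases lt_or_gt_of_ne hne with k | k
  · left; linarith
  · right; linarith
  · right; linarith
  · left; linarith

lemma UU (c : Cfg α δ σ0 P v w b0 sg kU kD bU bD bR nxt IsR) {q q' p : Pt}
    (hq : IsQ P v w q) (hq' : IsQ P v w q') (h : q ≠ q')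
    (hp : p ∈ bendImage (w, bU q, q)) (hp' : p ∈ bendImage (w, bU q', q')) : p = w := by
  by_cases hs : sg q = sg q'
  · have a := c.aU q hq
    have a' := c.aU q' hq'
    rcases c.lt_or q hq hq' h with k | k
    · rw [← hs] at a'
      exact arm_arm_same a a' (c.sq q) (by norm_num) (c.tU q hq) (c.tU q' hq')
        (c.mU q q' hq hq' hs k) c.hδ (c.gap' q hq'.1 hq.1 k) hp hp'
    · rw [hs] at a k
      exact arm_arm_same a' a (c.sq q') (by norm_num) (c.tU q' hq') (c.tU q hq)
        (c.mU q' q hq' hq hs.symm k) c.hδ (c.gap' q' hq.1 hq'.1 k) hp' hp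
  · have a' := c.aU q' hq'
    have k := c.wsw hq'
    rw [c.opp hs] at a' k
    exact arm_arm_opp (c.aU q hq) a' (c.sq q) (by norm_num) (c.tU q hq) (c.tU q' hq') c.hδ
      (c.wsw hq) k hp hp'

lemma DD (c : Cfg α δ σ0 P v w b0 sg kU kD bU bD bR nxt IsR) {q q' p : Pt}
    (hq : IsQ P v w q) (hq' : IsQ P v w q') (h : q ≠ q')
    (hp : p ∈ bendImage (v, bD q, q)) (hp' : p ∈ bendImage (v, bD q', q')) : p = v := by
  by_cases hs : sg q = sg q'
  · have a := c.aD q hq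
    have a' := c.aD q' hq'
    rcases c.lt_or q hq hq' h with k | k
    · rw [← hs] at a'
      exact arm_arm_same a a' (c.sq q) (by norm_num) (c.tD q hq) (c.tD q' hq')
        (c.mD q q' hq hq' hs k) c.hδ (c.gap' q hq'.1 hq.1 k) hp hp'
    · rw [hs] at a k
      exact arm_arm_same a' a (c.sq q') (by norm_num) (c.tD q' hq') (c.tD q hq)
        (c.mD q' q hq' hq hs.symm k) c.hδ (c.gap' q' hq.1 hq'.1 k) hp' hp
  · have a' := c.aD q' hq'
    have k := c.wsv hq'
    rw [c.opp hs] at a' k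
    exact arm_arm_opp (c.aD q hq) a' (c.sq q) (by norm_num) (c.tD q hq) (c.tD q' hq') c.hδ
      (c.wsv hq) k hp hp'

lemma locU (c : Cfg α δ σ0 P v w b0 sg kU kD bU bD bR nxt IsR) {q p : Pt}
    (hq : IsQ P v w q) (hp : p ∈ bendImage (w, bU q, q)) :
    p = w ∨ w 1 < p 1 ∨ p = q ∨ (|p 0 - q 0| < δ ∧ q 1 < p 1) := by
  rcases (c.aU q hq).loc (c.sq q) (by norm_num) (c.tU q hq) hp with h | h | h | h
  · exact Or.inl h
  · exact Or.inr (Or.inl (by linarith [h.1]))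
  · exact Or.inr (Or.inr (Or.inl h))
  · exact Or.inr (Or.inr (Or.inr ⟨c.abs_lt q h.1 h.2.1.le, by linarith [h.2.2]⟩))

lemma locD (c : Cfg α δ σ0 P v w b0 sg kU kD bU bD bR nxt IsR) {q p : Pt}
    (hq : IsQ P v w q) (hp : p ∈ bendImage (v, bD q, q)) :
    p = v ∨ p 1 < v 1 ∨ p = q ∨ (|p 0 - q 0| < δ ∧ p 1 < q 1) := by
  rcases (c.aD q hq).loc (c.sq q) (by norm_num) (c.tD q hq) hp with h | h | h | h
  · exact Or.inl h
  · exact Or.inr (Or.inl (by linarith [h.1]))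
  · exact Or.inr (Or.inr (Or.inl h))
  · exact Or.inr (Or.inr (Or.inr ⟨c.abs_lt q h.1 h.2.1.le, by linarith [h.2.2]⟩))

lemma close2 (c : Cfg α δ σ0 P v w b0 sg kU kD bU bD bR nxt IsR) {p q r : Pt} (hq : q ∈ P)
    (hr : r ∈ P) (h : |p 0 - q 0| < δ) (h' : |p 0 - r 0| < δ) : q = r := by
  apply c.eq_of_close hq hr
  rw [_root_.abs_lt] at h h'
  rw [abs_le]
  constructor <;> linarith [h.1, h.2, h'.1, h'.2]

lemma UD (c : Cfg α δ σ0 P v w b0 sg kU kD bU bD bR nxt IsR) {q q' p : Pt}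
    (hq : IsQ P v w q) (hq' : IsQ P v w q')
    (hp : p ∈ bendImage (w, bU q, q)) (hp' : p ∈ bendImage (v, bD q', q')) : p = q ∧ q = q' := by
  have m := c.my hq
  have m' := c.my hq'
  have n := c.nf.vw
  have z0 : ∀ r : Pt, |r 0 - r 0| < δ := fun r => by simpa using c.hδ
  rcases c.locU hq hp with h | h | h | h <;> rcases c.locD hq' hp' with h' | h' | h' | h'
  · rw [h] at h'; rw [h'] at n; linarith
  · rw [h] at h'; linarith
  · exact absurd (h'.symm.trans h) hq'.2.2
  · rw [h] at h'; linarith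
  · rw [h'] at h; linarith
  · linarith
  · rw [h'] at h; linarith
  · linarith
  · exact absurd (h.symm.trans h') hq.2.1
  · rw [h] at h'; linarith
  · exact ⟨h, h.symm.trans h'⟩
  · rw [h] at h'
    have := c.close2 hq.1 hq'.1 (z0 q) h'.1
    rw [this] at h'; linarith [h'.2]
  · rw [h'] at h; linarith [h.2]
  · linarith [h.2]
  · rw [h'] at h
    have := c.close2 hq.1 hq'.1 h.1 (z0 q')
    rw [this] at h; linarith [h.2]
  · have := c.close2 hq.1 hq'.1 h.1 h'.1
    rw [this] at h; linarith [h.2, h'.2]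

lemma locR (c : Cfg α δ σ0 P v w b0 sg kU kD bU bD bR nxt IsR) {q p : Pt}
    (hq : IsR q) (hp : p ∈ bendImage (q, bR q, nxt q)) :
    0 ≤ sg q * (p 0 - q 0) ∧ 0 ≤ sg q * (nxt q 0 - p 0) := (c.rb q hq).xle (c.sq q) hp

lemma sgne (c : Cfg α δ σ0 P v w b0 sg kU kD bU bD bR nxt IsR) {q q' p : Pt}
    (h1 : 0 < sg q * (p 0 - w 0)) (h2 : 0 < sg q' * (p 0 - w 0)) : sg q = sg q' := by
  by_contra h
  rw [c.opp h] at h2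
  linarith

/-- A point of the path edge close to a vertex. -/
lemma boxR (c : Cfg α δ σ0 P v w b0 sg kU kD bU bD bR nxt IsR) {q q' p : Pt}
    (hq : IsR q) (hq' : IsQ P v w q') (hp : p ∈ bendImage (q, bR q, nxt q))
    (h : |p 0 - q' 0| < δ) : q' = q ∨ q' = nxt q := by
  obtain ⟨r1, r2⟩ := c.locR hq hp
  have hQ := c.rQ q hq
  have hN := c.nQ q hq
  have hd := c.hδ
  by_contra hcon
  push Not at hcon
  rw [_root_.abs_lt] at h
  have k1 := c.wsw hQ
  have k3 : sg q = sg q' := by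
    by_contra hne
    have := c.wsw hq'
    rw [c.opp hne] at this
    rcases c.hsg q with e | e <;> rw [e] at this r1 k1 <;> linarith [h.1, h.2]
  rcases c.nbt q hq q' hq' k3.symm with k | k
  · rcases c.lt_or q hQ hq' hcon.1.symm with l | l
    · linarith
    · have := c.gap' q hQ.1 hq'.1 l
      rcases c.hsg q with e | e <;> rw [e] at this r1 <;> linarith [h.1, h.2]
  · rcases c.lt_or q hN hq' hcon.2.symm with l | l
    · have := c.gap' q hq'.1 hN.1 l
      rcases c.hsg q with e | e <;> rw [e] at this r2 <;> linarith [h.1, h.2]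
    · linarith

lemma swR (c : Cfg α δ σ0 P v w b0 sg kU kD bU bD bR nxt IsR) {q p : Pt}
    (hq : IsR q) (hp : p ∈ bendImage (q, bR q, nxt q)) : 0 < sg q * (p 0 - w 0) := by
  linarith [(c.locR hq hp).1, c.sw q (c.rQ q hq)]

lemma svR (c : Cfg α δ σ0 P v w b0 sg kU kD bU bD bR nxt IsR) {q p : Pt}
    (hq : IsR q) (hp : p ∈ bendImage (q, bR q, nxt q)) : 2 * δ < sg q * (p 0 - v 0) := by
  linarith [(c.locR hq hp).1, c.wsv (c.rQ q hq)]

lemma yR (c : Cfg α δ σ0 P v w b0 sg kU kD bU bD bR nxt IsR) {q p : Pt}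
    (hq : IsR q) (hp : p ∈ bendImage (q, bR q, nxt q)) : v 1 < p 1 :=
  (c.rb q hq).ylow (c.sq q) (c.my (c.rQ q hq)).1 (c.my (c.nQ q hq)).1 hp

lemma fanpos (c : Cfg α δ σ0 P v w b0 sg kU kD bU bD bR nxt IsR) {q q' r : Pt}
    (hr : IsQ P v w r) (hs : sg r = sg q) (hq' : IsQ P v w q') :
    0 < (r 0 - w 0) * (sg q * cos (α - kU q')) + (r 1 - w 1) * (- sin (α - kU q')) := by
  have t := c.tU q' hq'
  have h1 := c.sw r hr
  rw [hs] at h1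
  have h2 := mul_pos h1 t.ct
  have h3 := mul_pos (sub_pos.2 (c.my hr).2) t.st
  linarith

lemma UR (c : Cfg α δ σ0 P v w b0 sg kU kD bU bD bR nxt IsR) {q q' p : Pt}
    (hq : IsR q) (hq' : IsQ P v w q') (hp : p ∈ bendImage (q, bR q, nxt q))
    (hp' : p ∈ bendImage (w, bU q', q')) : p = q' ∧ (q' = q ∨ q' = nxt q) := by
  have hQ := c.rQ q hq
  have hN := c.nQ q hq
  have hw := c.swR hq hp
  have t' := c.tU q' hq'
  have hw' : sg q' = sg q := by
    rcases (c.aU q' hq').side (c.sq q') (by norm_num) t' c.hδ (c.wsw hq') hp' with h | h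
    · rw [h] at hw; simp at hw
    · exact c.sgne h hw
  rcases (c.aU q' hq').img p hp' with ⟨l, l0, e0, e1, h2⟩ | ⟨m, m0, e0, e1, h2, -⟩
  · exfalso
    have := bend_pos (A := sg q * cos (α - kU q')) (B := - sin (α - kU q')) (o := w) hp
      (c.fanpos hQ rfl hq') (by have := c.rU q hq q' hq' hw'; linarith)
      (c.fanpos hN (c.nsg q hq) hq')
    rw [hw'] at e0
    have e : (p 0 - w 0) * (sg q * cos (α - kU q')) + (p 1 - w 1) * (- sin (α - kU q')) = 0 := by
      linear_combination cos (α - kU q') * e0 - sin (α - kU q') * e1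
    linarith
  · have msk := mul_nonneg m0 t'.sk.le
    have hb : |p 0 - q' 0| < δ := c.abs_lt q' (by linarith) (by linarith)
    have hc := c.boxR hq hq' hp hb
    refine ⟨?_, hc⟩
    rcases hc with rfl | hc
    · have := (c.locR hq hp).1
      have m1 : m * sin (kU q') = 0 := by linarith
      have m2 : m = 0 := (mul_eq_zero.1 m1).resolve_right t'.sk.ne'
      rw [m2, zero_mul] at e0 e1
      exact eq_of_scaled (c.sq q') (by norm_num) (by linarith) e1
    · have k2 := c.rU2 q hq
      have k3 := c.rU3 q hq
      rw [← hc] at k2 k3 hp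
      rcases bend_neg_or (A := sg q * cos (kU q')) (B := sin (kU q')) hp (by linarith)
        (by linarith) with h | h
      · exact h
      · exfalso
        rw [hw'] at e0
        have e : (p 0 - q' 0) * (sg q * cos (kU q')) + (p 1 - q' 1) * sin (kU q') = 0 := by
          linear_combination cos (kU q') * e0 + sin (kU q') * e1
        linarith

lemma DR (c : Cfg α δ σ0 P v w b0 sg kU kD bU bD bR nxt IsR) {q q' p : Pt}
    (hq : IsR q) (hq' : IsQ P v w q') (hp : p ∈ bendImage (q, bR q, nxt q))
    (hp' : p ∈ bendImage (v, bD q', q')) : p = q' ∧ (q' = q ∨ q' = nxt q) := by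
  have hv := c.yR hq hp
  have t' := c.tD q' hq'
  rcases (c.aD q' hq').img p hp' with ⟨l, l0, e0, e1, h2⟩ | ⟨m, m0, e0, e1, h2, -⟩
  · exfalso
    have := mul_nonneg l0 t'.ct.le
    linarith
  · have msk := mul_nonneg m0 t'.sk.le
    have hb : |p 0 - q' 0| < δ := c.abs_lt q' (by linarith) (by linarith)
    have hc := c.boxR hq hq' hp hb
    refine ⟨?_, hc⟩
    have m2 : m = 0 := by
      rcases hc with rfl | hc
      · have := (c.locR hq hp).1
        have m1 : m * sin (kD q') = 0 := by linarith
        exact (mul_eq_zero.1 m1).resolve_right t'.sk.ne'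
      · have k1 := ((c.rb q hq).loc (c.sq q) hp).2
        have k2 := c.rD q hq
        have k3 := c.nsg q hq
        rw [← hc] at k1 k2 k3
        rw [k3] at e0
        by_contra hne
        have := mul_pos_of_neg_of_neg k2 (neg_lt_zero.2 (lt_of_le_of_ne m0 (Ne.symm hne)))
        have e : (p 1 - q 1) * (sg q * (q' 0 - q 0)) - (q' 1 - q 1) * (sg q * (p 0 - q 0)) =
            (-(cos (kD q') * (sg q * (q' 0 - q 0))) + sin (kD q') * (q' 1 - q 1)) * m := by
          linear_combination -(sg q * (q' 0 - q 0)) * e1 - (q' 1 - q 1) * e0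
        linarith
    rw [m2, zero_mul] at e0 e1
    exact eq_of_scaled (c.sq q') (by norm_num) (by linarith) e1

lemma RR_aux (c : Cfg α δ σ0 P v w b0 sg kU kD bU bD bR nxt IsR) {q q' p : Pt}
    (hq : IsR q) (hq' : IsR q') (hs : sg q' = sg q) (h : 0 < sg q * (q' 0 - q 0))
    (hp : p ∈ bendImage (q, bR q, nxt q)) (hp' : p ∈ bendImage (q', bR q', nxt q')) :
    p = q' ∧ q' = nxt q := by
  have hN := c.nQ q hq
  have hQ' := c.rQ q' hq'
  obtain ⟨r1, r2⟩ := c.locR hq hp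
  obtain ⟨r1', r2'⟩ := c.locR hq' hp'
  rw [hs] at r1' r2'
  rcases c.nbt q hq q' hQ' hs with k | k
  · linarith
  have e : q' = nxt q := by
    by_contra hne
    rcases c.lt_or q hQ' hN hne with l | l
    · linarith
    · linarith
  refine ⟨?_, e⟩
  rw [← e] at r2
  rcases ((c.rb q' hq').loc (c.sq q') hp').1 with h | h | h
  · exact h
  · have k := (c.rb q' hq').l
    have k' := (c.rb q' hq').r
    rw [hs] at k k'
    rw [h] at r2
    linarith
  · rw [hs] at h; linarith [h.1]

lemma RR (c : Cfg α δ σ0 P v w b0 sg kU kD bU bD bR nxt IsR) {q q' p : Pt}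
    (hq : IsR q) (hq' : IsR q') (hne : q ≠ q')
    (hp : p ∈ bendImage (q, bR q, nxt q)) (hp' : p ∈ bendImage (q', bR q', nxt q')) :
    (p = q' ∧ q' = nxt q) ∨ (p = q ∧ q = nxt q') := by
  have hs := c.sgne (c.swR hq hp) (c.swR hq' hp')
  rcases c.lt_or q (c.rQ q hq) (c.rQ q' hq') hne with l | l
  · exact Or.inl (c.RR_aux hq hq' hs.symm l hp hp')
  · rw [hs] at l
    exact Or.inr (c.RR_aux hq' hq hs l hp' hp)

lemma VR (c : Cfg α δ σ0 P v w b0 sg kU kD bU bD bR nxt IsR) {q p : Pt}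
    (hq : IsR q) (hp : p ∈ bendImage (q, bR q, nxt q)) (hp' : p ∈ bendImage (v, b0, w)) : False :=
  c.vw.far c.hδ (c.s0 q) hp' (by linarith [c.svR hq hp, c.hδ]) (c.swR hq hp)

lemma VU (c : Cfg α δ σ0 P v w b0 sg kU kD bU bD bR nxt IsR) {q p : Pt}
    (hq : IsQ P v w q) (hp : p ∈ bendImage (w, bU q, q)) (hp' : p ∈ bendImage (v, b0, w)) : p = w :=
  c.vw.armU c.hδ (c.sq q) (c.s0 q) (c.aU q hq) (c.tU q hq) (c.wsv hq) (c.wsw hq) hp' hp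

lemma VD (c : Cfg α δ σ0 P v w b0 sg kU kD bU bD bR nxt IsR) {q p : Pt}
    (hq : IsQ P v w q) (hp : p ∈ bendImage (v, bD q, q)) (hp' : p ∈ bendImage (v, b0, w)) : p = v :=
  c.vw.armD c.hδ (c.sq q) (c.s0 q) (c.aD q hq) (c.tD q hq) (c.wsv hq) (c.wsw hq) hp' hp

lemma PU (c : Cfg α δ σ0 P v w b0 sg kU kD bU bD bR nxt IsR) {q p : Pt} (hP : p ∈ P)
    (hq : IsQ P v w q) (hp : p ∈ bendImage (w, bU q, q)) : p = w ∨ p = q := by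
  rcases c.locU hq hp with h | h | h | h
  · exact Or.inl h
  · linarith [c.nf.le_w hP]
  · exact Or.inr h
  · exact Or.inr (c.eq_of_close hP hq.1 (by linarith [h.1, c.hδ]))

lemma PD (c : Cfg α δ σ0 P v w b0 sg kU kD bU bD bR nxt IsR) {q p : Pt} (hP : p ∈ P)
    (hq : IsQ P v w q) (hp : p ∈ bendImage (v, bD q, q)) : p = v ∨ p = q := by
  rcases c.locD hq hp with h | h | h | h
  · exact Or.inl h
  · linarith [c.nf.ge_v hP]
  · exact Or.inr h
  · exact Or.inr (c.eq_of_close hP hq.1 (by linarith [h.1, c.hδ]))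

lemma PR (c : Cfg α δ σ0 P v w b0 sg kU kD bU bD bR nxt IsR) {q p : Pt} (hP : p ∈ P)
    (hq : IsR q) (hp : p ∈ bendImage (q, bR q, nxt q)) : p = q ∨ p = nxt q := by
  have hQ : IsQ P v w p := by
    refine ⟨hP, fun h => ?_, fun h => ?_⟩
    · have := c.svR hq hp
      rw [h, sub_self, mul_zero] at this; linarith [c.hδ]
    · have := c.swR hq hp
      rw [h, sub_self, mul_zero] at this; linarith
  exact c.boxR hq hQ hp (by simpa using c.hδ)

lemma PV (c : Cfg α δ σ0 P v w b0 sg kU kD bU bD bR nxt IsR) {p : Pt} (hP : p ∈ P)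
    (hp : p ∈ bendImage (v, b0, w)) : p = v ∨ p = w := by
  by_contra h
  push Not at h
  have hQ : IsQ P v w p := ⟨hP, h.1, h.2⟩
  exact c.vw.far c.hδ (c.s0 p) hp (by linarith [c.wsv hQ, c.hδ]) (c.sw p hQ)

end Cfg


/-- Compatibility of two edges. -/
def Compat (e f : Pt × Pt × Pt) : Prop :=
  edgeEndpoints e ≠ edgeEndpoints f ∧
    ∀ p, p ∈ bendImage e → p ∈ bendImage f → p ∈ edgeEndpoints e ∧ p ∈ edgeEndpoints f

lemma Compat.symm {e f : Pt × Pt × Pt} (h : Compat e f) : Compat f e :=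
  ⟨h.1.symm, fun p hp hq => (h.2 p hq hp).symm⟩

lemma ends_sub (e : Pt × Pt × Pt) : edgeEndpoints e ⊆ bendImage e := by
  rintro p (h | h)
  · rw [h]; exact Or.inl (left_mem_segment _ _ _)
  · rw [mem_singleton_iff] at h
    rw [h]; exact Or.inr (right_mem_segment _ _ _)

lemma graph_of_compat {α : ℝ} {P : Finset Pt} {E : Finset (Pt × Pt × Pt)}
    (h1 : ∀ e ∈ E, IsBendEdge α e ∧ e.1 ∈ P ∧ e.2.2 ∈ P)
    (h2 : ∀ e ∈ E, ∀ v ∈ P, v ∈ bendImage e → v ∈ edgeEndpoints e)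
    (h3 : ∀ e ∈ E, ∀ f ∈ E, e ≠ f → Compat e f) : IsPlaneBendGraph α P E := by
  refine ⟨⟨h1, ?_, h2, ?_⟩, fun e he f hf hne => (h3 e he f hf hne).1⟩
  · intro e he f hf hne heq
    obtain ⟨k1, k2⟩ := h3 e he f hf hne
    apply k1
    apply Subset.antisymm
    · intro p hp
      have := ends_sub e hp
      exact (k2 p this (heq ▸ this)).2
    · intro p hp
      have := ends_sub f hp
      exact (k2 p (heq ▸ this) this).1
  · rintro e he f hf hne p ⟨hp, hq⟩
    exact (h3 e he f hf hne).2 p hp hq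

namespace Cfg

variable {α δ σ0 : ℝ} {P : Finset Pt} {v w b0 : Pt} {sg kU kD : Pt → ℝ}
    {bU bD bR nxt : Pt → Pt} {IsR : Pt → Prop}

lemma vne (c : Cfg α δ σ0 P v w b0 sg kU kD bU bD bR nxt IsR) : v ≠ w := fun h => by
  have := c.nf.vw; rw [h] at this; exact lt_irrefl _ this

lemma nne (c : Cfg α δ σ0 P v w b0 sg kU kD bU bD bR nxt IsR) {q : Pt} (hq : IsR q) :
    0 < sg q * (nxt q 0 - q 0) := by
  linarith [(c.rb q hq).l, (c.rb q hq).r]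

/-- The shape of edges. -/
inductive Shape (P : Finset Pt) (v w b0 : Pt) (bU bD bR nxt : Pt → Pt) (IsR : Pt → Prop) :
    Pt × Pt × Pt → Prop
  | U (q : Pt) (h : IsQ P v w q) : Shape P v w b0 bU bD bR nxt IsR (w, bU q, q)
  | D (q : Pt) (h : IsQ P v w q) : Shape P v w b0 bU bD bR nxt IsR (v, bD q, q)
  | R (q : Pt) (h : IsR q) : Shape P v w b0 bU bD bR nxt IsR (q, bR q, nxt q)
  | V : Shape P v w b0 bU bD bR nxt IsR (v, b0, w)

lemma compat (c : Cfg α δ σ0 P v w b0 sg kU kD bU bD bR nxt IsR) {e f : Pt × Pt × Pt}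
    (he : Shape P v w b0 bU bD bR nxt IsR e) (hf : Shape P v w b0 bU bD bR nxt IsR f)
    (hne : e ≠ f) : Compat e f := by
  have cUD : ∀ q q', IsQ P v w q → IsQ P v w q' → Compat (w, bU q, q) (v, bD q', q') := by
    intro q q' h h'
    refine ⟨?_, fun p hp hp' => ?_⟩
    · intro e
      simp only [edgeEndpoints] at e
      rw [Set.pair_eq_pair_iff] at e
      rcases e with e | e
      · exact c.vne e.1.symm
      · exact h.2.1 e.2
    · obtain ⟨k1, k2⟩ := c.UD h h' hp hp'
      simp [edgeEndpoints, k1, ← k2]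
  have cUR : ∀ q q', IsQ P v w q → IsR q' → Compat (w, bU q, q) (q', bR q', nxt q') := by
    intro q q' h h'
    refine ⟨?_, fun p hp hp' => ?_⟩
    · intro e
      simp only [edgeEndpoints] at e
      rw [Set.pair_eq_pair_iff] at e
      rcases e with e | e
      · exact (c.rQ q' h').2.2 e.1.symm
      · exact (c.nQ q' h').2.2 e.1.symm
    · obtain ⟨k1, k2⟩ := c.UR h' h hp' hp
      simp only [edgeEndpoints, mem_insert_iff, mem_singleton_iff]
      rw [k1]; exact ⟨Or.inr rfl, k2⟩
  have cUV : ∀ q, IsQ P v w q → Compat (w, bU q, q) (v, b0, w) := by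
    intro q h
    refine ⟨?_, fun p hp hp' => ?_⟩
    · intro e
      simp only [edgeEndpoints] at e
      rw [Set.pair_eq_pair_iff] at e
      rcases e with e | e
      · exact h.2.2 e.2
      · exact h.2.1 e.2
    · have := c.VU h hp hp'
      simp [edgeEndpoints, this]
  have cDR : ∀ q q', IsQ P v w q → IsR q' → Compat (v, bD q, q) (q', bR q', nxt q') := by
    intro q q' h h'
    refine ⟨?_, fun p hp hp' => ?_⟩
    · intro e
      simp only [edgeEndpoints] at e
      rw [Set.pair_eq_pair_iff] at e
      rcases e with e | e
      · exact (c.rQ q' h').2.1 e.1.symm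
      · exact (c.nQ q' h').2.1 e.1.symm
    · obtain ⟨k1, k2⟩ := c.DR h' h hp' hp
      simp only [edgeEndpoints, mem_insert_iff, mem_singleton_iff]
      rw [k1]; exact ⟨Or.inr rfl, k2⟩
  have cDV : ∀ q, IsQ P v w q → Compat (v, bD q, q) (v, b0, w) := by
    intro q h
    refine ⟨?_, fun p hp hp' => ?_⟩
    · intro e
      simp only [edgeEndpoints] at e
      rw [Set.pair_eq_pair_iff] at e
      rcases e with e | e
      · exact h.2.2 e.2
      · exact h.2.1 e.2
    · have := c.VD h hp hp'
      simp [edgeEndpoints, this]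
  have cRV : ∀ q, IsR q → Compat (q, bR q, nxt q) (v, b0, w) := by
    intro q h
    refine ⟨?_, fun p hp hp' => (c.VR h hp hp').elim⟩
    intro e
    simp only [edgeEndpoints] at e
    rw [Set.pair_eq_pair_iff] at e
    rcases e with e | e
    · exact (c.rQ q h).2.1 e.1
    · exact (c.rQ q h).2.2 e.1
  rcases he with ⟨q, h⟩ | ⟨q, h⟩ | ⟨q, h⟩ | _ <;> rcases hf with ⟨q', h'⟩ | ⟨q', h'⟩ | ⟨q', h'⟩ | _
  · have hqq : q ≠ q' := fun k => hne (by rw [k])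
    refine ⟨?_, fun p hp hp' => ?_⟩
    · intro e
      simp only [edgeEndpoints] at e
      rw [Set.pair_eq_pair_iff] at e
      rcases e with e | e
      · exact hqq e.2
      · exact h.2.2 e.2
    · have := c.UU h h' hqq hp hp'
      simp [edgeEndpoints, this]
  · exact cUD q q' h h'
  · exact cUR q q' h h'
  · exact cUV q h
  · exact (cUD q' q h' h).symm
  · have hqq : q ≠ q' := fun k => hne (by rw [k])
    refine ⟨?_, fun p hp hp' => ?_⟩
    · intro e
      simp only [edgeEndpoints] at e
      rw [Set.pair_eq_pair_iff] at e
      rcases e with e | e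
      · exact hqq e.2
      · exact h.2.1 e.2
    · have := c.DD h h' hqq hp hp'
      simp [edgeEndpoints, this]
  · exact cDR q q' h h'
  · exact cDV q h
  · exact (cUR q' q h' h).symm
  · exact (cDR q' q h' h).symm
  · have hqq : q ≠ q' := fun k => hne (by rw [k])
    refine ⟨?_, fun p hp hp' => ?_⟩
    · intro e
      simp only [edgeEndpoints] at e
      rw [Set.pair_eq_pair_iff] at e
      rcases e with e | ⟨e1, e2⟩
      · exact hqq e.1
      · have k1 := c.nne h
        have k2 := c.nne h'
        have k3 := c.nsg q h
        rw [e2] at k1 k3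
        rw [k3, ← e1] at k2
        linarith
    · simp only [edgeEndpoints, mem_insert_iff, mem_singleton_iff]
      rcases c.RR h h' hqq hp hp' with ⟨k1, k2⟩ | ⟨k1, k2⟩
      · exact ⟨Or.inr (k1.trans k2), Or.inl k1⟩
      · exact ⟨Or.inl k1, Or.inr (k1.trans k2)⟩
  · exact cRV q h
  · exact (cUV q' h').symm
  · exact (cDV q' h').symm
  · exact (cRV q' h').symm
  · exact absurd rfl hne

open Classical in
lemma graph (c : Cfg α δ σ0 P v w b0 sg kU kD bU bD bR nxt IsR) :
    ∃ E, IsPlaneBendGraph α P E ∧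
      E.card = 2 * (P.filter (IsQ P v w)).card + (P.filter IsR).card + 1 := by
  set FQ := P.filter (IsQ P v w) with hFQ
  set FR := P.filter IsR with hFR
  set EU := FQ.image (fun q => (w, bU q, q)) with hEU
  set ED := FQ.image (fun q => (v, bD q, q)) with hED
  set ER := FR.image (fun q => (q, bR q, nxt q)) with hER
  have mU : ∀ e ∈ EU, ∃ q, IsQ P v w q ∧ e = (w, bU q, q) := by
    intro e he
    obtain ⟨q, hq, rfl⟩ := Finset.mem_image.1 he
    exact ⟨q, (Finset.mem_filter.1 hq).2, rfl⟩
  have mD : ∀ e ∈ ED, ∃ q, IsQ P v w q ∧ e = (v, bD q, q) := by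
    intro e he
    obtain ⟨q, hq, rfl⟩ := Finset.mem_image.1 he
    exact ⟨q, (Finset.mem_filter.1 hq).2, rfl⟩
  have mR : ∀ e ∈ ER, ∃ q, IsR q ∧ e = (q, bR q, nxt q) := by
    intro e he
    obtain ⟨q, hq, rfl⟩ := Finset.mem_image.1 he
    exact ⟨q, (Finset.mem_filter.1 hq).2, rfl⟩
  have sh : ∀ e ∈ (EU ∪ ED) ∪ ER ∪ {(v, b0, w)}, Shape P v w b0 bU bD bR nxt IsR e := by
    intro e he
    simp only [Finset.mem_union, Finset.mem_singleton] at he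
    rcases he with ((he | he) | he) | rfl
    · obtain ⟨q, hq, rfl⟩ := mU e he
      exact .U q hq
    · obtain ⟨q, hq, rfl⟩ := mD e he
      exact .D q hq
    · obtain ⟨q, hq, rfl⟩ := mR e he
      exact .R q hq
    · exact .V
  refine ⟨(EU ∪ ED) ∪ ER ∪ {(v, b0, w)}, graph_of_compat ?_ ?_ ?_, ?_⟩
  · intro e he
    rcases sh e he with ⟨q, h⟩ | ⟨q, h⟩ | ⟨q, h⟩ | _
    · exact ⟨⟨h.2.2.symm, (c.aU q h).ang⟩, c.nf.hw, h.1⟩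
    · exact ⟨⟨h.2.1.symm, (c.aD q h).ang⟩, c.nf.hv, h.1⟩
    · refine ⟨⟨fun k => ?_, (c.rb q h).ang⟩, (c.rQ q h).1, (c.nQ q h).1⟩
      have k2 := c.nne h
      simp only at k
      rw [← k] at k2
      simp at k2
    · exact ⟨⟨c.vne, c.vw.ang⟩, c.nf.hv, c.nf.hw⟩
  · intro e he p hP hp
    rcases sh e he with ⟨q, h⟩ | ⟨q, h⟩ | ⟨q, h⟩ | _
    · exact c.PU hP h hp
    · exact c.PD hP h hp
    · exact c.PR hP h hp
    · exact c.PV hP hp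
  · intro e he f hf hne
    exact c.compat (sh e he) (sh f hf) hne
  · have d1 : Disjoint EU ED := by
      rw [Finset.disjoint_left]
      intro e h1 h2
      obtain ⟨q, hq, rfl⟩ := mU e h1
      obtain ⟨q', hq', h⟩ := mD _ h2
      exact c.vne (congrArg Prod.fst h).symm
    have d2 : Disjoint (EU ∪ ED) ER := by
      rw [Finset.disjoint_left]
      intro e h1 h2
      obtain ⟨q', hq', rfl⟩ := mR _ h2
      rcases Finset.mem_union.1 h1 with h1 | h1
      · obtain ⟨q, hq, h⟩ := mU _ h1
        exact (c.rQ q' hq').2.2 (congrArg Prod.fst h)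
      · obtain ⟨q, hq, h⟩ := mD _ h1
        exact (c.rQ q' hq').2.1 (congrArg Prod.fst h)
    have d3 : Disjoint ((EU ∪ ED) ∪ ER) {(v, b0, w)} := by
      rw [Finset.disjoint_singleton_right]
      intro h
      rcases Finset.mem_union.1 h with h | h
      · rcases Finset.mem_union.1 h with h1 | h1
        · obtain ⟨q, hq, h⟩ := mU _ h1
          exact c.vne (congrArg Prod.fst h)
        · obtain ⟨q, hq, h⟩ := mD _ h1
          exact hq.2.2 (congrArg (fun x => x.2.2) h).symm
      · obtain ⟨q, hq, h⟩ := mR _ h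
        exact (c.rQ q hq).2.1 (congrArg Prod.fst h).symm
    rw [Finset.card_union_of_disjoint d3, Finset.card_union_of_disjoint d2,
      Finset.card_union_of_disjoint d1, Finset.card_singleton,
      Finset.card_image_of_injective _ (fun a b h => congrArg (fun x => x.2.2) h),
      Finset.card_image_of_injective _ (fun a b h => congrArg (fun x => x.2.2) h),
      Finset.card_image_of_injective _ (fun a b h => congrArg Prod.fst h)]
    ring

end Cfg


lemma scale_ev {φ : ℝ → Prop} (h : ∀ᶠ κ in 𝓝[>] (0:ℝ), φ κ) {c : ℝ} (hc : 0 < c) :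
    ∀ᶠ ε in 𝓝[>] (0:ℝ), φ (ε * c) := by
  have ht : Tendsto (fun ε : ℝ => ε * c) (𝓝[>] 0) (𝓝[>] 0) := by
    rw [tendsto_nhdsWithin_iff]
    constructor
    · have : ContinuousAt (fun ε : ℝ => ε * c) 0 := by fun_prop
      have h2 := this.tendsto.mono_left (nhdsWithin_le_nhds (s := Ioi 0))
      simpa using h2
    · filter_upwards [self_mem_nhdsWithin] with ε hε
      exact mul_pos hε hc
  exact ht.eventually h

lemma cont_ev {f : ℝ → ℝ} (hf : ContinuousAt f 0) (h : 0 < f 0) : ∀ᶠ κ in 𝓝[>] (0:ℝ), 0 < f κ :=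
  (hf.eventually (lt_mem_nhds h)).filter_mono nhdsWithin_le_nhds

lemma delta_exists (P : Finset Pt) (hx : ∀ p ∈ P, ∀ q ∈ P, p 0 = q 0 → p = q) :
    ∃ δ : ℝ, 0 < δ ∧ ∀ p ∈ P, ∀ q ∈ P, p ≠ q → 2 * δ < |p 0 - q 0| := by
  have h : ∀ᶠ δ in 𝓝[>] (0:ℝ), ∀ p ∈ P, ∀ q ∈ P, p ≠ q → 0 < |p 0 - q 0| - 2 * δ := by
    rw [eventually_all_finset]
    intro p hp
    rw [eventually_all_finset]
    intro q hq
    by_cases hpq : p = q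
    · exact Eventually.of_forall fun _ h => absurd hpq h
    · refine (cont_ev (f := fun δ => |p 0 - q 0| - 2 * δ) (by fun_prop) ?_).mono fun _ h _ => h
      simp only [mul_zero, sub_zero]
      exact abs_pos.2 (sub_ne_zero.2 fun e => hpq (hx p hp q hq e))
  obtain ⟨δ, h1, h2⟩ := (h.and self_mem_nhdsWithin).exists
  exact ⟨δ, h2, fun p hp q hq hne => by linarith [h1 p hp q hq hne]⟩

open Classical in
lemma cfg_exists {α : ℝ} (hα : α ∈ Set.Ioc 0 (π/2)) {P : Finset Pt} {v w : Pt}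
    (nf : NiceFrame α P v w) :
    ∃ δ σ0 b0 sg kU kD bU bD bR nxt IsR, Cfg α δ σ0 P v w b0 sg kU kD bU bD bR nxt IsR ∧
      (∀ q, IsQ P v w q → (∃ q', IsQ P v w q' ∧ ((v 0 < q 0 ∧ v 0 < q' 0 ∧ q 0 < q' 0) ∨
        (q 0 < v 0 ∧ q' 0 < v 0 ∧ q' 0 < q 0))) → IsR q) := by
  obtain ⟨δ, hδ, gap⟩ := delta_exists P nf.xinj
  set sg : Pt → ℝ := fun q => if v 0 < q 0 then 1 else -1 with hsgd
  have hsg : ∀ q, sg q = 1 ∨ sg q = -1 := by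
    intro q; simp only [sg]; split_ifs <;> simp
  have sq : ∀ q, sg q * sg q = 1 := by
    intro q; rcases hsg q with h | h <;> rw [h] <;> norm_num
  have sgR : ∀ q, v 0 < q 0 → sg q = 1 := fun q h => if_pos h
  have sgL : ∀ q, q 0 < v 0 → sg q = -1 := fun q h => if_neg (by linarith)
  have sv : ∀ q, IsQ P v w q → 0 < sg q * (q 0 - v 0) := by
    intro q hq
    rcases nf.side q hq.1 hq.2.1 hq.2.2 with h | h
    · rw [sgR q h.1]; linarith
    · rw [sgL q h.1]; linarith
  have sw : ∀ q, IsQ P v w q → 0 < sg q * (q 0 - w 0) := by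
    intro q hq
    rcases nf.side q hq.1 hq.2.1 hq.2.2 with h | h
    · rw [sgR q h.1]; linarith
    · rw [sgL q h.1]; linarith
  have my : ∀ q, IsQ P v w q → v 1 < q 1 ∧ q 1 < w 1 := fun q hq => nf.mid q hq.1 hq.2.1 hq.2.2
  set IsR : Pt → Prop := fun q => IsQ P v w q ∧
    ∃ q', IsQ P v w q' ∧ sg q' = sg q ∧ 0 < sg q * (q' 0 - q 0) with hIsR
  have hnx : ∀ q, IsR q → ∃ n, IsQ P v w n ∧ sg n = sg q ∧ 0 < sg q * (n 0 - q 0) ∧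
      ∀ q', IsQ P v w q' → sg q' = sg q → sg q * (q' 0 - q 0) ≤ 0 ∨ 0 ≤ sg q * (q' 0 - n 0) := by
    rintro q ⟨hq, q1, h1, h2, h3⟩
    obtain ⟨n, hn, hmin⟩ := Finset.exists_min_image
      (P.filter fun q' => IsQ P v w q' ∧ sg q' = sg q ∧ 0 < sg q * (q' 0 - q 0))
      (fun q' => sg q * q' 0) ⟨q1, Finset.mem_filter.2 ⟨h1.1, h1, h2, h3⟩⟩
    obtain ⟨-, n1, n2, n3⟩ := Finset.mem_filter.1 hn
    refine ⟨n, n1, n2, n3, fun q' k1 k2 => ?_⟩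
    by_cases k3 : 0 < sg q * (q' 0 - q 0)
    · right
      have := hmin q' (Finset.mem_filter.2 ⟨k1.1, k1, k2, k3⟩)
      linarith
    · left; linarith
  choose! nxt nQ nsg nlt nbt using hnx
  have hbr : ∀ q, IsR q → ∃ b, RB α (sg q) w q b (nxt q) := fun q hq =>
    rb_exists hα (sq q) (nlt q hq) (sw q hq.1) (my q hq.1).2 (my _ (nQ q hq)).2
  choose! bR rb using hbr
  have hvw : ∃ σ0 b0, (σ0 = 1 ∨ σ0 = -1) ∧ VWB α δ σ0 v b0 w := by
    have hne : v 0 ≠ w 0 := fun e => by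
      have h1 := nf.vw
      rw [nf.xinj v nf.hv w nf.hw e] at h1
      exact lt_irrefl _ h1
    have hst := nf.steep
    rcases lt_or_gt_of_ne hne with h | h
    · rw [abs_of_pos (by linarith)] at hst
      obtain ⟨b, hb⟩ := vwb_exists (σ := 1) hα hδ (by norm_num) (by linarith) nf.vw (by linarith)
      exact ⟨1, b, Or.inl rfl, hb⟩
    · rw [abs_of_neg (by linarith)] at hst
      obtain ⟨b, hb⟩ := vwb_exists (σ := -1) hα hδ (by norm_num) (by linarith) nf.vw (by linarith)
      exact ⟨-1, b, Or.inr rfl, hb⟩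
  obtain ⟨σ0, b0, hσ0, vw⟩ := hvw
  have c3 : ∀ᶠ κ in 𝓝[>] (0:ℝ), TiltOK α κ := by
    filter_upwards [Ioo_mem_nhdsGT hα.1] with κ hκ
    exact ⟨hκ.1, hκ.2, hα.2⟩
  have all : ∀ {φ : Pt → ℝ → Prop} {S : Pt → Prop}, (∀ q, S q → q ∈ P) →
      (∀ q, S q → ∀ᶠ ε in 𝓝[>] (0:ℝ), φ q ε) → ∀ᶠ ε in 𝓝[>] (0:ℝ), ∀ q, S q → φ q ε := by
    intro φ S hS h
    have : ∀ᶠ ε in 𝓝[>] (0:ℝ), ∀ q ∈ P, S q → φ q ε := by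
      rw [eventually_all_finset]
      intro q _
      by_cases hq : S q
      · exact (h q hq).mono fun _ k _ => k
      · exact Eventually.of_forall fun _ k => absurd k hq
    exact this.mono fun ε k q hq => k q (hS q hq) hq
  have hRP : ∀ q, IsR q → q ∈ P := fun q hq => hq.1.1
  have hQP : ∀ q, IsQ P v w q → q ∈ P := fun q hq => hq.1
  have eU : ∀ᶠ ε in 𝓝[>] (0:ℝ), ∀ q, IsQ P v w q → TiltOK α (ε * (sg q * (q 0 - w 0))) ∧
      ∃ b, Arm α δ (sg q) 1 (ε * (sg q * (q 0 - w 0))) w q b :=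
    all hQP fun q hq => scale_ev (c3.and (arm_exists hα hδ (sq q) (by norm_num) (sw q hq)
      (by linarith [(my q hq).2]))) (sw q hq)
  have eD : ∀ᶠ ε in 𝓝[>] (0:ℝ), ∀ q, IsQ P v w q → TiltOK α (ε * (sg q * (q 0 - v 0))) ∧
      ∃ b, Arm α δ (sg q) (-1) (ε * (sg q * (q 0 - v 0))) v q b :=
    all hQP fun q hq => scale_ev (c3.and (arm_exists hα hδ (sq q) (by norm_num) (sv q hq)
      (by linarith [(my q hq).1]))) (sv q hq)
  have e1 : ∀ᶠ ε in 𝓝[>] (0:ℝ), ∀ q, IsR q → ∀ q', IsQ P v w q' →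
      0 < sg q * (bR q 0 - w 0) * cos (α - ε * (sg q' * (q' 0 - w 0))) -
        (bR q 1 - w 1) * sin (α - ε * (sg q' * (q' 0 - w 0))) :=
    all hRP fun q hq => all hQP fun q' hq' => by
      refine cont_ev (by fun_prop) ?_
      simpa using (rb q hq).below
  have e2 : ∀ᶠ ε in 𝓝[>] (0:ℝ), ∀ q, IsR q →
      0 < - (sg q * (bR q 0 - nxt q 0) * cos (ε * (sg (nxt q) * (nxt q 0 - w 0))) +
    (bR q 1 - nxt q 1) * sin (ε * (sg (nxt q) * (nxt q 0 - w 0)))) :=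
    all hRP fun q hq => by
      refine cont_ev (by fun_prop) ?_
      have := (rb q hq).r
      simp only [zero_mul, cos_zero, sin_zero, mul_zero]
      linarith
  have e3 : ∀ᶠ ε in 𝓝[>] (0:ℝ), ∀ q, IsR q →
      0 < - (sg q * (q 0 - nxt q 0) * cos (ε * (sg (nxt q) * (nxt q 0 - w 0))) +
    (q 1 - nxt q 1) * sin (ε * (sg (nxt q) * (nxt q 0 - w 0)))) :=
    all hRP fun q hq => by
      refine cont_ev (by fun_prop) ?_
      have := nlt q hq
      simp only [zero_mul, cos_zero, sin_zero, mul_zero]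
      linarith
  have e4 : ∀ᶠ ε in 𝓝[>] (0:ℝ), ∀ q, IsR q →
      0 < - (- (cos (ε * (sg (nxt q) * (nxt q 0 - v 0))) * (sg q * (nxt q 0 - q 0))) +
    sin (ε * (sg (nxt q) * (nxt q 0 - v 0))) * (nxt q 1 - q 1)) :=
    all hRP fun q hq => by
      refine cont_ev (by fun_prop) ?_
      have := nlt q hq
      simp only [zero_mul, cos_zero, sin_zero]
      linarith
  obtain ⟨ε, ⟨⟨⟨⟨⟨aU, aD⟩, e1⟩, e2⟩, e3⟩, e4⟩, hε⟩ :=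
    ((((((eU.and eD).and e1).and e2).and e3).and e4).and self_mem_nhdsWithin).exists
  have hε : 0 < ε := hε
  choose! tU bU aU using aU
  choose! tD bD aD using aD
  refine ⟨δ, σ0, b0, sg, fun q => ε * (sg q * (q 0 - w 0)), fun q => ε * (sg q * (q 0 - v 0)),
    bU, bD, bR, nxt, IsR, ?_, ?_⟩
  · constructor
    · exact nf
    · exact hα.1
    · exact hα.2
    · exact hδ
    · exact gap
    · exact hσ0
    · exact hsg
    · exact sv
    · exact sw
    · exact tU
    · exact tD
    · intro q q' _ _ h1 h2
      have := mul_pos hε h2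
      rw [← h1]; linarith
    · intro q q' _ _ h1 h2
      have := mul_pos hε h2
      rw [← h1]; linarith
    · exact aU
    · exact aD
    · exact fun q hq => hq.1
    · exact nQ
    · exact nsg
    · exact nbt
    · exact rb
    · exact fun q hq q' hq' _ => e1 q hq q' hq'
    · exact fun q hq => by linarith [e2 q hq]
    · exact fun q hq => by linarith [e3 q hq]
    · exact fun q hq => by linarith [e4 q hq]
    · exact vw
  · rintro q hq ⟨q', hq', h | h⟩
    · refine ⟨hq, q', hq', ?_, ?_⟩
      · rw [sgR q h.1, sgR q' h.2.1]
      · rw [sgR q h.1]; linarith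
    · refine ⟨hq, q', hq', ?_, ?_⟩
      · rw [sgL q h.1, sgL q' h.2.1]
      · rw [sgL q h.1]; linarith

open Classical in
theorem nice_graph {α : ℝ} (hα : α ∈ Set.Ioc 0 (π/2)) {P : Finset Pt} {v w : Pt}
    (nf : NiceFrame α P v w) : ∃ E, IsPlaneBendGraph α P E ∧
      2*(P.card-2)+1+((rightPts P v w).card-1)+((leftPts P v w).card-1) ≤ E.card := by
  obtain ⟨δ, σ0, b0, sg, kU, kD, bU, bD, bR, nxt, IsR, c, hR⟩ := cfg_exists hα nf
  obtain ⟨E, hE, hcard⟩ := c.graph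
  refine ⟨E, hE, ?_⟩
  have h1 : P.filter (IsQ P v w) = (P.erase v).erase w := by
    ext q
    simp only [Finset.mem_filter, Finset.mem_erase, IsQ]
    tauto
  have h2 : (P.filter (IsQ P v w)).card = P.card - 2 := by
    rw [h1, Finset.card_erase_of_mem (Finset.mem_erase.2 ⟨c.vne.symm, nf.hw⟩),
      Finset.card_erase_of_mem nf.hv]
    omega
  have qR : ∀ q ∈ rightPts P v w, IsQ P v w q := by
    intro q hq
    obtain ⟨k1, k2, k3⟩ := Finset.mem_filter.1 hq
    exact ⟨k1, fun e => by rw [e] at k2; exact lt_irrefl _ k2,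
      fun e => by rw [e] at k3; exact lt_irrefl _ k3⟩
  have qL : ∀ q ∈ leftPts P v w, IsQ P v w q := by
    intro q hq
    obtain ⟨k1, k2, k3⟩ := Finset.mem_filter.1 hq
    exact ⟨k1, fun e => by rw [e] at k2; exact lt_irrefl _ k2,
      fun e => by rw [e] at k3; exact lt_irrefl _ k3⟩
  have s1 : ∃ A ⊆ rightPts P v w, A ⊆ P.filter IsR ∧ A.card = (rightPts P v w).card - 1 := by
    rcases (rightPts P v w).eq_empty_or_nonempty with h | h
    · exact ⟨∅, by simp, by simp, by simp [h]⟩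
    · obtain ⟨m, hm, hmax⟩ := Finset.exists_max_image (rightPts P v w) (fun q => q 0) h
      refine ⟨(rightPts P v w).erase m, Finset.erase_subset _ _, ?_, Finset.card_erase_of_mem hm⟩
      intro q hq
      obtain ⟨k1, k2⟩ := Finset.mem_erase.1 hq
      obtain ⟨l1, l2, l3⟩ := Finset.mem_filter.1 k2
      obtain ⟨m1, m2, m3⟩ := Finset.mem_filter.1 hm
      refine Finset.mem_filter.2 ⟨l1, hR q (qR q k2) ⟨m, qR m hm, Or.inl ⟨l2, m2, ?_⟩⟩⟩
      exact lt_of_le_of_ne (hmax q k2) fun e => k1 (nf.xinj q l1 m m1 e)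
  have s2 : ∃ A ⊆ leftPts P v w, A ⊆ P.filter IsR ∧ A.card = (leftPts P v w).card - 1 := by
    rcases (leftPts P v w).eq_empty_or_nonempty with h | h
    · exact ⟨∅, by simp, by simp, by simp [h]⟩
    · obtain ⟨m, hm, hmin⟩ := Finset.exists_min_image (leftPts P v w) (fun q => q 0) h
      refine ⟨(leftPts P v w).erase m, Finset.erase_subset _ _, ?_, Finset.card_erase_of_mem hm⟩
      intro q hq
      obtain ⟨k1, k2⟩ := Finset.mem_erase.1 hq
      obtain ⟨l1, l2, l3⟩ := Finset.mem_filter.1 k2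
      obtain ⟨m1, m2, m3⟩ := Finset.mem_filter.1 hm
      refine Finset.mem_filter.2 ⟨l1, hR q (qL q k2) ⟨m, qL m hm, Or.inr ⟨l2, m2, ?_⟩⟩⟩
      exact lt_of_le_of_ne (hmin q k2) fun e => k1 (nf.xinj q l1 m m1 e.symm)
  obtain ⟨A, a1, a2, a3⟩ := s1
  obtain ⟨B, b1, b2, b3⟩ := s2
  have hd : Disjoint A B := by
    rw [Finset.disjoint_left]
    intro q hA hB
    have k1 := (Finset.mem_filter.1 (a1 hA)).2.1
    have k2 := (Finset.mem_filter.1 (b1 hB)).2.1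
    linarith
  have := Finset.card_le_card (Finset.union_subset a2 b2)
  rw [Finset.card_union_of_disjoint hd, a3, b3] at this
  rw [hcard, h2]
  omega


/-- Rotation. -/
def rotl (φ : ℝ) : Pt ≃ₗᵢ[ℝ] Pt where
  toFun p := !₂[cos φ * p 0 - sin φ * p 1, sin φ * p 0 + cos φ * p 1]
  invFun p := !₂[cos φ * p 0 + sin φ * p 1, - sin φ * p 0 + cos φ * p 1]
  map_add' p q := by
    refine pt_ext ?_ ?_ <;> simp <;> ring
  map_smul' c p := by
    refine pt_ext ?_ ?_ <;> simp <;> ring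
  left_inv p := by
    refine pt_ext ?_ ?_
    · simp; linear_combination p 0 * sin_sq_add_cos_sq φ
    · simp; linear_combination p 1 * sin_sq_add_cos_sq φ
  right_inv p := by
    refine pt_ext ?_ ?_
    · simp; linear_combination p 0 * sin_sq_add_cos_sq φ
    · simp; linear_combination p 1 * sin_sq_add_cos_sq φ
  norm_map' p := by
    rw [EuclideanSpace.norm_eq, EuclideanSpace.norm_eq]
    congr 1
    simp
    linear_combination (p 0 ^ 2 + p 1 ^ 2) * sin_sq_add_cos_sq φ

lemma rotl_zero (φ : ℝ) (p : Pt) : rotl φ p 0 = cos φ * p 0 - sin φ * p 1 := rfl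
lemma rotl_one (φ : ℝ) (p : Pt) : rotl φ p 1 = sin φ * p 0 + cos φ * p 1 := rfl

/-- Map of edges. -/
def emap (S : Pt ≃ₗᵢ[ℝ] Pt) (e : Pt × Pt × Pt) : Pt × Pt × Pt := (S e.1, S e.2.1, S e.2.2)

lemma emap_inj (S : Pt ≃ₗᵢ[ℝ] Pt) : Function.Injective (emap S) := by
  rintro ⟨a, b, c⟩ ⟨a', b', c'⟩ h
  simp only [emap, Prod.mk.injEq, S.injective.eq_iff] at h
  simp [h]

lemma seg_map (S : Pt ≃ₗᵢ[ℝ] Pt) (a b : Pt) : segment ℝ (S a) (S b) = S '' segment ℝ a b :=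
  (image_segment ℝ (S.toLinearEquiv.toLinearMap.toAffineMap) a b).symm

lemma bend_map (S : Pt ≃ₗᵢ[ℝ] Pt) (e : Pt × Pt × Pt) : bendImage (emap S e) = S '' bendImage e := by
  simp only [bendImage, emap, seg_map, image_union]

lemma ends_map (S : Pt ≃ₗᵢ[ℝ] Pt) (e : Pt × Pt × Pt) :
    edgeEndpoints (emap S e) = S '' edgeEndpoints e := by
  simp only [edgeEndpoints, emap, image_pair]

open Classical in
lemma graph_map (S : Pt ≃ₗᵢ[ℝ] Pt) {α : ℝ} {V : Finset Pt} {E : Finset (Pt × Pt × Pt)}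
    (h : IsPlaneBendGraph α V E) : IsPlaneBendGraph α (V.image S) (E.image (emap S)) := by
  obtain ⟨⟨h1, h2, h3, h4⟩, h5⟩ := h
  have inj := S.injective.image_injective
  refine ⟨⟨?_, ?_, ?_, ?_⟩, ?_⟩
  · rintro e he
    obtain ⟨e, he₀, rfl⟩ := Finset.mem_image.1 he; clear he; have he := he₀
    obtain ⟨⟨k1, k2⟩, k3, k4⟩ := h1 e he
    refine ⟨⟨fun k => k1 (S.injective k), ?_⟩, Finset.mem_image_of_mem _ k3,
      Finset.mem_image_of_mem _ k4⟩
    rw [← k2]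
    simp only [EuclideanGeometry.angle, emap, vsub_eq_sub, ← map_sub]
    exact LinearIsometry.angle_map S.toLinearIsometry _ _
  · intro e he f hf hne
    obtain ⟨e, he₀, rfl⟩ := Finset.mem_image.1 he; clear he; have he := he₀
    obtain ⟨f, hf₀, rfl⟩ := Finset.mem_image.1 hf; clear hf; have hf := hf₀
    rw [bend_map, bend_map]
    exact fun k => h2 e he f hf (fun k => hne (by rw [k])) (inj k)
  · intro e he v hv hm
    obtain ⟨e, he₀, rfl⟩ := Finset.mem_image.1 he; clear he; have he := he₀
    obtain ⟨v, hv₀, rfl⟩ := Finset.mem_image.1 hv; clear hv; have hv := hv₀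
    rw [bend_map, S.injective.mem_set_image] at hm
    rw [ends_map, S.injective.mem_set_image]
    exact h3 e he v hv hm
  · intro e he f hf hne
    obtain ⟨e, he₀, rfl⟩ := Finset.mem_image.1 he; clear he; have he := he₀
    obtain ⟨f, hf₀, rfl⟩ := Finset.mem_image.1 hf; clear hf; have hf := hf₀
    rw [bend_map, bend_map, ends_map, ends_map, ← image_inter S.injective, ← image_inter S.injective]
    exact image_mono (h4 e he f hf (fun k => hne (by rw [k])))
  · intro e he f hf hne
    obtain ⟨e, he₀, rfl⟩ := Finset.mem_image.1 he; clear he; have he := he₀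
    obtain ⟨f, hf₀, rfl⟩ := Finset.mem_image.1 hf; clear hf; have hf := hf₀
    rw [ends_map, ends_map]
    exact fun k => h5 e he f hf (fun k => hne (by rw [k])) (inj k)

/-- Map of segments. -/
def smap (S : Pt ≃ₗᵢ[ℝ] Pt) (e : Pt × Pt) : Pt × Pt := (S e.1, S e.2)

lemma smap_inj (S : Pt ≃ₗᵢ[ℝ] Pt) : Function.Injective (smap S) := by
  rintro ⟨a, b⟩ ⟨a', b'⟩ h
  simp only [smap, Prod.mk.injEq, S.injective.eq_iff] at h
  simp [h]

open Classical in
lemma pslg_map (S : Pt ≃ₗᵢ[ℝ] Pt) {V : Finset Pt} {E : Finset (Pt × Pt)}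
    (h : IsPSLG V E) : IsPSLG (V.image S) (E.image (smap S)) := by
  obtain ⟨h1, h2, h3, h4⟩ := h
  have inj := S.injective.image_injective
  have sm : ∀ e : Pt × Pt, segment ℝ (smap S e).1 (smap S e).2 = S '' segment ℝ e.1 e.2 :=
    fun e => seg_map S _ _
  have em : ∀ e : Pt × Pt, ({(smap S e).1, (smap S e).2} : Set Pt) = S '' {e.1, e.2} :=
    fun e => by simp only [smap, image_pair]
  refine ⟨?_, ?_, ?_, ?_⟩
  · rintro e he
    obtain ⟨e, he₀, rfl⟩ := Finset.mem_image.1 he; clear he; have he := he₀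
    obtain ⟨k1, k2, k3⟩ := h1 e he
    exact ⟨Finset.mem_image_of_mem _ k1, Finset.mem_image_of_mem _ k2, fun k => k3 (S.injective k)⟩
  · intro e he f hf hne
    obtain ⟨e, he₀, rfl⟩ := Finset.mem_image.1 he; clear he; have he := he₀
    obtain ⟨f, hf₀, rfl⟩ := Finset.mem_image.1 hf; clear hf; have hf := hf₀
    rw [sm, sm]
    exact fun k => h2 e he f hf (fun k => hne (by rw [k])) (inj k)
  · intro e he v hv hm
    obtain ⟨e, he₀, rfl⟩ := Finset.mem_image.1 he; clear he; have he := he₀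
    obtain ⟨v, hv₀, rfl⟩ := Finset.mem_image.1 hv; clear hv; have hv := hv₀
    rw [sm, S.injective.mem_set_image] at hm
    rcases h3 e he v hv hm with k | k
    · exact Or.inl (by rw [k]; rfl)
    · exact Or.inr (by rw [k]; rfl)
  · intro e he f hf hne
    obtain ⟨e, he₀, rfl⟩ := Finset.mem_image.1 he; clear he; have he := he₀
    obtain ⟨f, hf₀, rfl⟩ := Finset.mem_image.1 hf; clear hf; have hf := hf₀
    rw [sm, sm, em, em, ← image_inter S.injective, ← image_inter S.injective]
    exact image_mono (h4 e he f hf (fun k => hne (by rw [k])))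

lemma polar' (X Y : ℝ) : ∃ ρ S : ℝ, 0 ≤ ρ ∧ X = ρ * sin S ∧ Y = ρ * cos S := by
  set z : ℂ := ⟨Y, X⟩
  exact ⟨‖z‖, z.arg, norm_nonneg _, (Complex.norm_mul_sin_arg z).symm,
    (Complex.norm_mul_cos_arg z).symm⟩

lemma ne_ev {A B : ℝ} (h : A ≠ 0 ∨ B ≠ 0) : ∀ᶠ θ in 𝓝[>] (0:ℝ), cos θ * A + sin θ * B ≠ 0 := by
  by_cases hA : A = 0
  · have hB : B ≠ 0 := h.resolve_left (by simpa using hA)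
    filter_upwards [Ioo_mem_nhdsGT pi_pos] with θ hθ
    rw [hA, mul_zero, zero_add]
    exact mul_ne_zero (sin_pos_of_pos_of_lt_pi hθ.1 hθ.2).ne' hB
  · have : ContinuousAt (fun θ : ℝ => cos θ * A + sin θ * B) 0 := by fun_prop
    exact (this.eventually (isOpen_ne.mem_nhds (by simpa using hA))).filter_mono nhdsWithin_le_nhds

/-- A nice rotation exists. -/
lemma frame_exists {α : ℝ} (hα : α ∈ Set.Ioc 0 (π/2)) {P : Finset Pt} (hcard : 3 ≤ P.card)
    (hgp : GenPos P) : ∃ φ : ℝ, ∃ a ∈ P, ∃ c ∈ P, ∃ P' : Finset Pt,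
      (∀ p, p ∈ P' ↔ ∃ q ∈ P, rotl φ q = p) ∧ NiceFrame α P' (rotl φ a) (rotl φ c) := by
  classical
  have hsin : 0 < sin α := sin_pos_of_pos_of_lt_pi hα.1 (by linarith [hα.2, pi_pos])
  have hne : (P ×ˢ P).Nonempty := by
    obtain ⟨p, hp⟩ := Finset.card_pos.1 (by omega : 0 < P.card)
    exact ⟨(p, p), Finset.mk_mem_product hp hp⟩
  obtain ⟨⟨a, c⟩, hac, hmax⟩ := Finset.exists_max_image (P ×ˢ P)
    (fun x => (x.1 0 - x.2 0) ^ 2 + (x.1 1 - x.2 1) ^ 2) hne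
  obtain ⟨ha, hc⟩ := Finset.mem_product.1 hac
  simp only at ha hc hmax
  have hmax' : ∀ p ∈ P, ∀ q ∈ P, (p 0 - q 0) ^ 2 + (p 1 - q 1) ^ 2 ≤ (a 0 - c 0) ^ 2 + (a 1 - c 1) ^ 2 :=
    fun p hp q hq => hmax (p, q) (Finset.mk_mem_product hp hq)
  obtain ⟨ρ, φ, hρ0, e0, e1⟩ := polar' (c 0 - a 0) (c 1 - a 1)
  have hρ : 0 < ρ := by
    refine lt_of_le_of_ne hρ0 fun h => ?_
    rw [← h, zero_mul] at e0 e1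
    obtain ⟨p, hp, q, hq, hpq⟩ := Finset.one_lt_card.1 (by omega : 1 < P.card)
    have := hmax' p hp q hq
    have z0 : a 0 - c 0 = 0 := by linarith
    have z1 : a 1 - c 1 = 0 := by linarith
    rw [z0, z1] at this
    apply hpq
    refine pt_ext ?_ ?_
    · nlinarith [sq_nonneg (p 0 - q 0), sq_nonneg (p 1 - q 1)]
    · nlinarith [sq_nonneg (p 0 - q 0), sq_nonneg (p 1 - q 1)]
  have hsc := sin_sq_add_cos_sq φ
  have hdist : (a 0 - c 0) ^ 2 + (a 1 - c 1) ^ 2 = ρ ^ 2 := by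
    have : (a 0 - c 0) ^ 2 + (a 1 - c 1) ^ 2 = (c 0 - a 0) ^ 2 + (c 1 - a 1) ^ 2 := by ring
    rw [this, e0, e1]; linear_combination ρ ^ 2 * hsc
  -- rotated relative coordinates
  set x : Pt → ℝ := fun q => cos φ * (q 0 - a 0) - sin φ * (q 1 - a 1) with hx
  set y : Pt → ℝ := fun q => sin φ * (q 0 - a 0) + cos φ * (q 1 - a 1) with hy
  have back0 : ∀ q, q 0 - a 0 = cos φ * x q + sin φ * y q := by
    intro q; simp only [x, y]; linear_combination -(q 0 - a 0) * hsc
  have back1 : ∀ q, q 1 - a 1 = - sin φ * x q + cos φ * y q := by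
    intro q; simp only [x, y]; linear_combination -(q 1 - a 1) * hsc
  have xa : x a = 0 := by simp [x]
  have ya : y a = 0 := by simp [y]
  have xc : x c = 0 := by simp only [x]; rw [e0, e1]; ring
  have yc : y c = ρ := by simp only [y]; rw [e0, e1]; linear_combination ρ * hsc
  have key : ∀ p q, x p = x q → y p = y q → p = q := by
    intro p q h h'
    have k0 := back0 p
    have k1 := back1 p
    rw [h, h', ← back0 q] at k0
    rw [h, h', ← back1 q] at k1
    exact pt_ext (by linarith) (by linarith)
  have hmid : ∀ q ∈ P, q ≠ a → q ≠ c → 0 < y q ∧ y q < ρ ∧ x q ≠ 0 := by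
    intro q hq hqa hqc
    have d1 := hmax' q hq a ha
    have d2 := hmax' q hq c hc
    have f1 : (q 0 - a 0) ^ 2 + (q 1 - a 1) ^ 2 = x q ^ 2 + y q ^ 2 := by
      rw [back0 q, back1 q]; linear_combination (x q ^ 2 + y q ^ 2) * hsc
    have f2 : (q 0 - c 0) ^ 2 + (q 1 - c 1) ^ 2 = x q ^ 2 + (y q - ρ) ^ 2 := by
      have g0 : q 0 - c 0 = cos φ * x q + sin φ * (y q - ρ) := by
        linear_combination back0 q - e0
      have g1 : q 1 - c 1 = - sin φ * x q + cos φ * (y q - ρ) := by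
        linear_combination back1 q - e1
      rw [g0, g1]; linear_combination (x q ^ 2 + (y q - ρ) ^ 2) * hsc
    rw [f1, hdist] at d1
    rw [f2, hdist] at d2
    refine ⟨?_, ?_, ?_⟩
    · by_contra h
      push Not at h
      have : ρ * y q ≤ 0 := mul_nonpos_of_nonneg_of_nonpos hρ0 h
      have s1 := sq_nonneg (x q)
      have s2 := sq_nonneg (y q)
      have t1 : x q = 0 := pow_eq_zero_iff two_ne_zero |>.1 (by linarith)
      have t2 : y q = 0 := pow_eq_zero_iff two_ne_zero |>.1 (by linarith)
      exact hqa (key q a (by rw [t1, xa]) (by rw [t2, ya]))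
    · by_contra h
      push Not at h
      have s1 := sq_nonneg (x q)
      have h2 : ρ ^ 2 ≤ y q ^ 2 := by gcongr
      have t1 : x q = 0 := pow_eq_zero_iff two_ne_zero |>.1 (by linarith)
      have t2 : y q ^ 2 = ρ ^ 2 := by linarith
      have t3 : y q = ρ := by
        have := (sq_eq_sq₀ (by linarith) hρ0).1 t2
        exact this
      exact hqc (key q c (by rw [t1, xc]) (by rw [t3, yc]))
    · intro h
      have hac' : a ≠ c := fun k => by rw [← k, ya] at yc; linarith
      apply hgp a ha c hc q hq hac' hqa.symm hqc.symm
      rw [collinear_iff_of_mem (p₀ := a) (by simp)]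
      refine ⟨!₂[sin φ, cos φ], ?_⟩
      intro p hp
      have : x p = 0 := by
        simp only [mem_insert_iff, mem_singleton_iff] at hp
        rcases hp with rfl | rfl | rfl
        · exact xa
        · exact xc
        · exact h
      refine ⟨y p, pt_ext ?_ ?_⟩
      · have := back0 p
        simp; rw [‹x p = 0›] at this; linarith
      · have := back1 p
        simp; rw [‹x p = 0›] at this; linarith
  -- rotated coordinates with angle φ + θ
  have X : ∀ θ p q, rotl (φ + θ) p 0 - rotl (φ + θ) q 0 = cos θ * (x p - x q) - sin θ * (y p - y q) := by
    intro θ p q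
    simp only [rotl_zero, x, y, cos_add, sin_add]; ring
  have Y : ∀ θ p q, rotl (φ + θ) p 1 - rotl (φ + θ) q 1 = sin θ * (x p - x q) + cos θ * (y p - y q) := by
    intro θ p q
    simp only [rotl_one, x, y, cos_add, sin_add]; ring
  have ev1 : ∀ᶠ θ in 𝓝[>] (0:ℝ), ∀ p ∈ P, ∀ q ∈ P, p ≠ q →
      rotl (φ + θ) p 0 ≠ rotl (φ + θ) q 0 ∧ rotl (φ + θ) p 1 ≠ rotl (φ + θ) q 1 := by
    rw [eventually_all_finset]
    intro p hp
    rw [eventually_all_finset]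
    intro q hq
    by_cases hpq : p = q
    · exact Eventually.of_forall fun _ h => absurd hpq h
    have hor : x p - x q ≠ 0 ∨ y p - y q ≠ 0 := by
      by_contra h
      push Not at h
      exact hpq (key p q (by linarith [h.1]) (by linarith [h.2]))
    have o1 := ne_ev (A := x p - x q) (B := -(y p - y q)) (hor.imp id neg_ne_zero.2)
    have o2 := ne_ev (A := y p - y q) (B := x p - x q) hor.symm
    filter_upwards [o1, o2] with θ h1 h2 _
    constructor
    · intro e
      apply h1
      have := X θ p q
      rw [e] at this; linarith
    · intro e
      apply h2
      have := Y θ p q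
      rw [e] at this; linarith
  have ev2 : ∀ᶠ θ in 𝓝[>] (0:ℝ), ∀ q ∈ P, q ≠ a → q ≠ c →
      0 < rotl (φ + θ) q 1 - rotl (φ + θ) a 1 ∧ 0 < rotl (φ + θ) c 1 - rotl (φ + θ) q 1 ∧
      ((0 < rotl (φ + θ) q 0 - rotl (φ + θ) a 0 ∧ 0 < rotl (φ + θ) q 0 - rotl (φ + θ) c 0) ∨
       (0 < rotl (φ + θ) a 0 - rotl (φ + θ) q 0 ∧ 0 < rotl (φ + θ) c 0 - rotl (φ + θ) q 0)) := by
    rw [eventually_all_finset]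
    intro q hq
    by_cases hqa : q = a
    · exact Eventually.of_forall fun _ h => absurd hqa h
    by_cases hqc : q = c
    · exact Eventually.of_forall fun _ _ h => absurd hqc h
    obtain ⟨m1, m2, m3⟩ := hmid q hq hqa hqc
    simp only [X, Y, xa, ya, xc, yc]
    have o1 : ∀ᶠ θ in 𝓝[>] (0:ℝ), 0 < sin θ * (x q - 0) + cos θ * (y q - 0) :=
      cont_ev (by fun_prop) (by simpa using m1)
    have o2 : ∀ᶠ θ in 𝓝[>] (0:ℝ), 0 < sin θ * (0 - x q) + cos θ * (ρ - y q) :=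
      cont_ev (by fun_prop) (by simpa using m2)
    have o3 : ∀ᶠ θ in 𝓝[>] (0:ℝ),
        ((0 < cos θ * (x q - 0) - sin θ * (y q - 0) ∧ 0 < cos θ * (x q - 0) - sin θ * (y q - ρ)) ∨
        (0 < cos θ * (0 - x q) - sin θ * (0 - y q) ∧ 0 < cos θ * (0 - x q) - sin θ * (ρ - y q))) := by
      rcases lt_or_gt_of_ne m3 with h | h
      · have l1 : ∀ᶠ θ in 𝓝[>] (0:ℝ), 0 < cos θ * (0 - x q) - sin θ * (0 - y q) :=
          cont_ev (by fun_prop) (by simpa using h)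
        have l2 : ∀ᶠ θ in 𝓝[>] (0:ℝ), 0 < cos θ * (0 - x q) - sin θ * (ρ - y q) :=
          cont_ev (by fun_prop) (by simpa using h)
        exact (l1.and l2).mono fun _ h => Or.inr h
      · have l1 : ∀ᶠ θ in 𝓝[>] (0:ℝ), 0 < cos θ * (x q - 0) - sin θ * (y q - 0) :=
          cont_ev (by fun_prop) (by simpa using h)
        have l2 : ∀ᶠ θ in 𝓝[>] (0:ℝ), 0 < cos θ * (x q - 0) - sin θ * (y q - ρ) :=
          cont_ev (by fun_prop) (by simpa using h)
        exact (l1.and l2).mono fun _ h => Or.inl h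
    exact (o1.and (o2.and o3)).mono fun _ h _ _ => h
  have ev3 : ∀ᶠ θ in 𝓝[>] (0:ℝ), 0 < rotl (φ + θ) c 1 - rotl (φ + θ) a 1 := by
    simp only [Y, xa, ya, xc, yc]
    exact cont_ev (by fun_prop) (by simpa using hρ)
  have ev4 : ∀ᶠ θ in 𝓝[>] (0:ℝ), 0 < sin α * (rotl (φ + θ) c 1 - rotl (φ + θ) a 1) -
      |rotl (φ + θ) c 0 - rotl (φ + θ) a 0| * cos α := by
    simp only [X, Y, xa, ya, xc, yc]
    exact cont_ev (by fun_prop) (by simpa using mul_pos hsin hρ)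
  obtain ⟨θ, k1, k2, k3, k4⟩ := (ev1.and (ev2.and (ev3.and ev4))).exists
  refine ⟨φ + θ, a, ha, c, hc, P.image (rotl (φ + θ)), fun p => Finset.mem_image, ?_⟩
  constructor
  · exact Finset.mem_image_of_mem _ ha
  · exact Finset.mem_image_of_mem _ hc
  · linarith
  · intro p hp q hq h
    obtain ⟨p, hp₀, rfl⟩ := Finset.mem_image.1 hp; clear hp; have hp := hp₀
    obtain ⟨q, hq₀, rfl⟩ := Finset.mem_image.1 hq; clear hq; have hq := hq₀
    by_contra hne
    exact (k1 p hp q hq (fun e => hne (by rw [e]))).1 h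
  · intro p hp q hq h
    obtain ⟨p, hp₀, rfl⟩ := Finset.mem_image.1 hp; clear hp; have hp := hp₀
    obtain ⟨q, hq₀, rfl⟩ := Finset.mem_image.1 hq; clear hq; have hq := hq₀
    by_contra hne
    exact (k1 p hp q hq (fun e => hne (by rw [e]))).2 h
  · intro q hq h1 h2
    obtain ⟨q, hq₀, rfl⟩ := Finset.mem_image.1 hq; clear hq; have hq := hq₀
    obtain ⟨l1, l2, l3⟩ := k2 q hq (fun e => h1 (by rw [e])) (fun e => h2 (by rw [e]))
    exact ⟨by linarith, by linarith⟩
  · intro q hq h1 h2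
    obtain ⟨q, hq₀, rfl⟩ := Finset.mem_image.1 hq; clear hq; have hq := hq₀
    obtain ⟨l1, l2, l3⟩ := k2 q hq (fun e => h1 (by rw [e])) (fun e => h2 (by rw [e]))
    rcases l3 with l | l
    · exact Or.inl ⟨by linarith [l.1], by linarith [l.2]⟩
    · exact Or.inr ⟨by linarith [l.1], by linarith [l.2]⟩
  · linarith

theorem stmt_main (P : Finset Pt) (hcard : 3 ≤ P.card) (hgp : GenPos P)
    (α : ℝ) (hα : α ∈ Set.Ioc 0 (π/2)) :
    ∃ E : Finset (Pt × Pt × Pt), IsPlaneBendGraph α P E ∧ 3 * P.card - 7 ≤ E.card ∧ M P ≤ E.card := by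
  classical
  obtain ⟨φ, a, ha, c, hc, P', hP', nf⟩ := frame_exists hα hcard hgp
  have hPe : P' = P.image (rotl φ) := by
    ext p; rw [hP', Finset.mem_image]
  obtain ⟨E, hE, hEc⟩ := nice_graph hα nf
  have hback : P'.image (rotl φ).symm = P := by
    rw [hPe, Finset.image_image]
    rw [show (⇑(rotl φ).symm ∘ ⇑(rotl φ)) = id from by funext p; simp, Finset.image_id]
  have hcP : P'.card = P.card := by
    rw [hPe, Finset.card_image_of_injective _ (rotl φ).injective]
  refine ⟨E.image (emap (rotl φ).symm), ?_, ?_, ?_⟩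
  · have := graph_map (rotl φ).symm hE
    rwa [hback] at this
  · rw [Finset.card_image_of_injective _ (emap_inj _)]
    have := nf.card
    omega
  · rw [Finset.card_image_of_injective _ (emap_inj _)]
    refine csSup_le ⟨0, ∅, ?_, rfl⟩ ?_
    · simp [IsPSLG]
    · rintro m ⟨F, hF, rfl⟩
      have h1 := pslg_map (rotl φ) hF
      rw [← hPe] at h1
      have h2 := PSLG_card_le h1 nf
      rw [Finset.card_image_of_injective _ (smap_inj _)] at h2
      omega

end

end BendProof

/-- For `P` in general position with `n ≥ 3` points and `α ∈ (0,π/2]`, there is a plane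
`α`-bend graph on `P` with at least `3n-7` edges, and one with at least `M P` edges. -/
theorem stmt_9 (P : Finset Pt) (hcard : 3 ≤ P.card) (hgp : GenPos P)
    (α : ℝ) (hα : α ∈ Set.Ioc 0 (π/2)) :
    (∃ E : Finset (Pt × Pt × Pt), IsPlaneBendGraph α P E ∧ 3 * P.card - 7 ≤ E.card) ∧
    (∃ E : Finset (Pt × Pt × Pt), IsPlaneBendGraph α P E ∧ M P ≤ E.card) := by
  obtain ⟨E, h1, h2, h3⟩ := stmt_main P hcard hgp α hα
  exact ⟨⟨E, h1, h2⟩, ⟨E, h1, h3⟩⟩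
end
end

section
/- Let α ∈ (0, π/2] and let S be a finite set of segments in ℝ² such that any two segments of S that cross do so at angle α. (a) If π/α is irrational, or π/α = p/q for coprime positive integers p, q with p even, then there exists a subset S′ ⊆ S of pairwise noncrossing segments with 2·|S′| ≥ |S|. (b) If π/α = p/q for coprime positive integers p, q with p = 2k+1 odd (k ∈ ℕ, k ≥ 1), then there exists a subset S′ ⊆ S of pairwise noncrossing segments with (2k+1)·|S′| ≥ k·|S|. -/
open EuclideanGeometry Real Set

noncomputable section

theorem exists_coloring {G : Type*} [AddCommGroup G] (a : G) (N : ℕ)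
    (hN : N ∣ addOrderOf a) : ∃ c : G → ZMod N, ∀ x, c (x + a) = c x + 1 := by
  have key : ∀ x : G, ∃ m : ℤ,
      x - (QuotientAddGroup.mk x : G ⧸ AddSubgroup.zmultiples a).out = m • a := by
    intro x
    obtain ⟨h, hh⟩ := QuotientAddGroup.mk_out_eq_add (AddSubgroup.zmultiples a) x
    obtain ⟨m, hm⟩ := AddSubgroup.mem_zmultiples_iff.1 h.2
    refine ⟨-m, ?_⟩
    rw [hh, ← hm]
    simp
  choose m hm using key
  refine ⟨fun x => (m x : ZMod N), fun x => ?_⟩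
  have h1 : (QuotientAddGroup.mk (x + a) : G ⧸ AddSubgroup.zmultiples a)
      = QuotientAddGroup.mk x := by
    rw [QuotientAddGroup.eq]
    refine AddSubgroup.mem_zmultiples_iff.2 ⟨-1, ?_⟩
    simp
  have h2 := hm (x + a)
  rw [h1] at h2
  have h3 : (m (x + a) - (m x + 1)) • a = 0 := by
    rw [sub_smul, add_smul, ← h2, ← hm x, one_smul]
    abel
  have h4 : (addOrderOf a : ℤ) ∣ m (x + a) - (m x + 1) :=
    addOrderOf_dvd_iff_zsmul_eq_zero.2 h3
  have h5 : (N : ℤ) ∣ m (x + a) - (m x + 1) := (Int.natCast_dvd_natCast.2 hN).trans h4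
  have h6 := (ZMod.intCast_zmod_eq_zero_iff_dvd _ N).2 h5 
  push_cast at h6
  exact sub_eq_zero.1 h6

/-- Twice the direction angle of a vector. -/
def dirAngle (v : Pt) : Real.Angle :=
  (2 : ℕ) • ((Complex.arg (Complex.orthonormalBasisOneI.repr.symm v) : ℝ) : Real.Angle)

theorem dirAngle_of_angle {α : ℝ} {u v : Pt} (hu : u ≠ 0) (hv : v ≠ 0)
    (h : InnerProductGeometry.angle u v = α ∨ InnerProductGeometry.angle u v = π - α) :
    dirAngle u = dirAngle v + (2 : ℕ) • (α : Real.Angle) ∨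
    dirAngle v = dirAngle u + (2 : ℕ) • (α : Real.Angle) := by
  unfold dirAngle
  have e : InnerProductGeometry.angle (Complex.orthonormalBasisOneI.repr.symm u)
      (Complex.orthonormalBasisOneI.repr.symm v) = InnerProductGeometry.angle u v :=
    Complex.orthonormalBasisOneI.repr.symm.toLinearIsometry.angle_map u v
  have hu' : Complex.orthonormalBasisOneI.repr.symm u ≠ 0 := 
    (map_ne_zero_iff _ Complex.orthonormalBasisOneI.repr.symm.injective).2 hu
  have hv' : Complex.orthonormalBasisOneI.repr.symm v ≠ 0 := 
    (map_ne_zero_iff _ Complex.orthonormalBasisOneI.repr.symm.injective).2 hv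
  generalize Complex.orthonormalBasisOneI.repr.symm u = z at *
  generalize Complex.orthonormalBasisOneI.repr.symm v = w at *
  rw [← e, Complex.angle_eq_abs_arg hu' hv'] at h
  have hd := Complex.arg_div_coe_angle hu' hv'
  have hz : (z.arg : Real.Angle) = ((z / w).arg : ℝ) + (w.arg : ℝ) := by rw [hd]; abel
  have h2 : (2 : ℕ) • ((z / w).arg : Real.Angle) = (2 : ℕ) • (α : Real.Angle) ∨
      (2 : ℕ) • ((z / w).arg : Real.Angle) = - ((2 : ℕ) • (α : Real.Angle)) := by
    have h3 : (z / w).arg = α ∨ (z / w).arg = -α ∨ (z / w).arg = π - α ∨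
        (z / w).arg = α - π := by
      rcases abs_choice (z / w).arg with h' | h' <;> rw [h'] at h <;> rcases h with h | h
      · left; exact h
      · right; right; left; exact h
      · right; left; linarith
      · right; right; right; linarith
    rcases h3 with h3 | h3 | h3 | h3 <;> rw [h3]
    · left; rfl
    · right; simp
    · right; simp [smul_sub, Real.Angle.two_nsmul_coe_pi]
    · left; simp [smul_sub, Real.Angle.two_nsmul_coe_pi]
  rw [hz, smul_add]
  rcases h2 with h2 | h2 <;> rw [h2]
  · left; abel
  · right; abel

theorem dvd_order {α : ℝ} (hα : 0 < α) (N : ℕ)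
    (h : ∀ n m : ℕ, (n : ℝ) * α = m * π → N ∣ n) :
    N ∣ addOrderOf ((2 : ℕ) • (α : Real.Angle)) := by
  have h0 := addOrderOf_nsmul_eq_zero ((2 : ℕ) • (α : Real.Angle))
  generalize addOrderOf ((2 : ℕ) • (α : Real.Angle)) = n at *
  rw [← Real.Angle.natCast_mul_eq_nsmul, ← Real.Angle.natCast_mul_eq_nsmul,
    Real.Angle.coe_eq_zero_iff] at h0
  obtain ⟨m, hm⟩ := h0
  have hm' : (m : ℝ) * π = n * α := by
    rw [zsmul_eq_mul] at hm; push_cast at hm; linarith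
  have hm0 : 0 ≤ m := by
    by_contra hneg
    push Not at hneg
    have : (m : ℝ) < 0 := by exact_mod_cast hneg
    have h1 : (m : ℝ) * π < 0 := mul_neg_of_neg_of_pos this Real.pi_pos
    have h2 : 0 ≤ (n : ℝ) * α := by positivity
    linarith
  lift m to ℕ using hm0
  exact h n m (by push_cast at hm'; linarith)

theorem dvd_of_ratio {α : ℝ} (hα : 0 < α) {p q : ℕ} (hq : 0 < q) (hpq : Nat.Coprime p q)
    (h : π / α = (p : ℝ) / (q : ℝ)) (n m : ℕ) (hnm : (n : ℝ) * α = m * π) : p ∣ n := by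
  have hq' : (q : ℝ) ≠ 0 := by positivity
  rw [div_eq_div_iff hα.ne' hq'] at h
  have : (n : ℝ) * q = m * p := by
    have : α * ((n : ℝ) * q) = α * (m * p) := by linear_combination q * hnm + m * h
    exact mul_left_cancel₀ hα.ne' this
  have h2 : n * q = m * p := by exact_mod_cast this
  exact hpq.dvd_of_dvd_mul_right (h2 ▸ dvd_mul_left p m)

theorem two_dvd_of_irrational {α : ℝ} (hα : 0 < α) (h : Irrational (π / α))
    (n m : ℕ) (hnm : (n : ℝ) * α = m * π) : 2 ∣ n := by
  rcases Nat.eq_zero_or_pos n with rfl | hn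
  · simp
  exfalso
  have hn' : (0 : ℝ) < n := by exact_mod_cast hn
  have hm : (m : ℝ) ≠ 0 := by
    intro hm
    rw [hm, zero_mul] at hnm
    have : 0 < (n : ℝ) * α := by positivity
    linarith
  apply h
  refine ⟨(n : ℚ) / m, ?_⟩
  push_cast
  rw [div_eq_div_iff hm hα.ne']
  linarith

theorem comb_two {T : Type*} (S : Finset T) (R : T → T → Prop) (c : T → ZMod 2)
    (h : ∀ s ∈ S, ∀ t ∈ S, R s t → c s = c t + 1 ∨ c t = c s + 1) :
    ∃ S' ⊆ S, (∀ s ∈ S', ∀ t ∈ S', ¬ R s t) ∧ S.card ≤ 2 * S'.card := by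
  classical
  have main : ∀ i : ZMod 2, ∀ s ∈ S.filter (fun s => c s = i), ∀ t ∈ S.filter (fun s => c s = i),
      ¬ R s t := by
    intro i s hs t ht hR
    rw [Finset.mem_filter] at hs ht
    have := h s hs.1 t ht.1 hR
    rw [hs.2, ht.2] at this
    revert this
    clear hs ht
    revert i
    decide
  have hcard := Finset.card_eq_sum_card_fiberwise (f := c) (s := S) (t := Finset.univ)
    (fun _ _ => by simp)
  rw [show (Finset.univ : Finset (ZMod 2)) = {0, 1} from rfl,
    Finset.sum_pair (by decide)] at hcard
  rcases le_total (S.filter (fun s => c s = 0)).card (S.filter (fun s => c s = 1)).card with hh | hh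
  · exact ⟨_, Finset.filter_subset _ _, main 1, by omega⟩
  · exact ⟨_, Finset.filter_subset _ _, main 0, by omega⟩

theorem comb_odd {T : Type*} (S : Finset T) (R : T → T → Prop) (k : ℕ)
    (c : T → ZMod (2 * k + 1))
    (h : ∀ s ∈ S, ∀ t ∈ S, R s t → c s = c t + 1 ∨ c t = c s + 1) :
    ∃ S' ⊆ S, (∀ s ∈ S', ∀ t ∈ S', ¬ R s t) ∧ k * S.card ≤ (2 * k + 1) * S'.card := by
  classical
  have noadj : ∀ i < k, ∀ i' < k, ∀ j : ZMod (2 * k + 1),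
      j + 2 * (i : ZMod (2 * k + 1)) ≠ j + 2 * (i' : ZMod (2 * k + 1)) + 1 := by
    intro i hi i' hi' j he
    have h1 : ((2 * (i : ℤ) - 2 * i' - 1 : ℤ) : ZMod (2 * k + 1)) = 0 := by
      push_cast
      linear_combination he
    rw [ZMod.intCast_zmod_eq_zero_iff_dvd] at h1
    have h2 := Int.eq_zero_of_abs_lt_dvd h1 (by rw [abs_lt]; push_cast; omega)
    omega
  have inj : ∀ i < k, ∀ i' < k, ∀ x : ZMod (2 * k + 1),
      x - 2 * (i : ZMod (2 * k + 1)) = x - 2 * (i' : ZMod (2 * k + 1)) → i = i' := by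
    intro i hi i' hi' j he
    have h1 : ((2 * (i : ℤ) - 2 * i' : ℤ) : ZMod (2 * k + 1)) = 0 := by
      push_cast
      linear_combination -he
    rw [ZMod.intCast_zmod_eq_zero_iff_dvd] at h1
    have h2 := Int.eq_zero_of_abs_lt_dvd h1 (by rw [abs_lt]; push_cast; omega)
    omega
  let F : ZMod (2 * k + 1) → Finset T := fun j =>
    S.filter (fun s => ∃ i < k, c s = j + 2 * (i : ZMod (2 * k + 1)))
  have main : ∀ j, ∀ s ∈ F j, ∀ t ∈ F j, ¬ R s t := by
    intro j s hs t ht hR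
    simp only [F, Finset.mem_filter] at hs ht
    obtain ⟨hs, i, hi, h1⟩ := hs
    obtain ⟨ht, i', hi', h2⟩ := ht
    rcases h s hs t ht hR with h3 | h3
    · exact noadj i hi i' hi' j (by rw [← h1, ← h2, h3])
    · exact noadj i' hi' i hi j (by rw [← h1, ← h2, h3])
  have hsum : ∑ j, (F j).card = S.card * k := by
    have := Finset.sum_card_bipartiteAbove_eq_sum_card_bipartiteBelow
      (s := S) (t := (Finset.univ : Finset (ZMod (2 * k + 1))))
      (fun s j => ∃ i < k, c s = j + 2 * (i : ZMod (2 * k + 1)))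
    unfold Finset.bipartiteAbove Finset.bipartiteBelow at this
    simp only [F]
    rw [← this]
    apply Finset.sum_const_nat
    intro s _
    rw [show (Finset.univ.filter
        (fun j : ZMod (2 * k + 1) => ∃ i < k, c s = j + 2 * (i : ZMod (2 * k + 1))))
      = (Finset.range k).image (fun i : ℕ => c s - 2 * (i : ZMod (2 * k + 1))) from ?_]
    · rw [Finset.card_image_of_injOn, Finset.card_range]
      intro i hi i' hi' he
      exact inj i (by simpa using hi) i' (by simpa using hi') _ he
    · ext j
      simp only [Finset.mem_filter, Finset.mem_univ, true_and, Finset.mem_image,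
        Finset.mem_range]
      constructor
      · rintro ⟨i, hi, he⟩
        exact ⟨i, hi, by rw [he]; ring⟩
      · rintro ⟨i, hi, he⟩
        exact ⟨i, hi, by rw [← he]; ring⟩
  by_contra hno
  push Not at hno
  have hlt : ∀ j, (2 * k + 1) * (F j).card < k * S.card := fun j =>
    hno (F j) (Finset.filter_subset _ _) (main j)
  have h1 : ∑ j, (2 * k + 1) * (F j).card < ∑ _j : ZMod (2 * k + 1), k * S.card :=
    Finset.sum_lt_sum_of_nonempty Finset.univ_nonempty (fun j _ => hlt j)
  rw [← Finset.mul_sum, hsum, Finset.sum_const, Finset.card_univ, ZMod.card, smul_eq_mul,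
    mul_comm S.card] at h1
  exact lt_irrefl _ h1

/-- Lemma on segments whose pairwise crossings are all at angle `α`: a large subset of
pairwise noncrossing segments can be selected, with ratio `1/2` in the irrational/even
case and `k/(2k+1)` in the odd case. -/
theorem stmt_17 (α : ℝ) (hα : α ∈ Set.Ioc 0 (π/2))
    (S : Finset (Pt × Pt)) (hseg : ∀ s ∈ S, s.1 ≠ s.2)
    (hcross : ∀ s ∈ S, ∀ t ∈ S, SegCross s t →
      (InnerProductGeometry.angle (s.2 - s.1) (t.2 - t.1) = α ∨
       InnerProductGeometry.angle (s.2 - s.1) (t.2 - t.1) = π - α)) :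
    ((Irrational (π / α) ∨
        ∃ p q : ℕ, 0 < p ∧ 0 < q ∧ Nat.Coprime p q ∧ Even p ∧ π / α = (p : ℝ) / (q : ℝ)) →
      ∃ S' ⊆ S, (∀ s ∈ S', ∀ t ∈ S', ¬ SegCross s t) ∧ S.card ≤ 2 * S'.card) ∧
    (∀ k q : ℕ, 1 ≤ k → 0 < q → Nat.Coprime (2 * k + 1) q →
      π / α = ((2 * k + 1 : ℕ) : ℝ) / (q : ℝ) →
      ∃ S' ⊆ S, (∀ s ∈ S', ∀ t ∈ S', ¬ SegCross s t) ∧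
        k * S.card ≤ (2 * k + 1) * S'.card) := by
  have hα0 : 0 < α := hα.1
  have col : ∀ N : ℕ, (∀ n m : ℕ, (n : ℝ) * α = m * π → N ∣ n) →
      ∃ c : Pt × Pt → ZMod N, ∀ s ∈ S, ∀ t ∈ S, SegCross s t →
        c s = c t + 1 ∨ c t = c s + 1 := by
    intro N hN
    obtain ⟨c, hc⟩ := exists_coloring _ N (dvd_order hα0 N hN)
    refine ⟨fun s => c (dirAngle (s.2 - s.1)), fun s hs t ht hst => ?_⟩
    rcases dirAngle_of_angle (sub_ne_zero.2 (hseg s hs).symm)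
      (sub_ne_zero.2 (hseg t ht).symm) (hcross s hs t ht hst) with h | h
    · left; dsimp only; rw [h]; exact hc _
    · right; dsimp only; rw [h]; exact hc _
  constructor
  · intro h
    have h2 : ∀ n m : ℕ, (n : ℝ) * α = m * π → 2 ∣ n := by
      rcases h with h | ⟨p, q, _, hq, hpq, hev, h⟩
      · exact two_dvd_of_irrational hα0 h
      · exact fun n m hnm => hev.two_dvd.trans (dvd_of_ratio hα0 hq hpq h n m hnm)
    obtain ⟨c, hc⟩ := col 2 h2
    exact comb_two S SegCross c hc
  · intro k q _ hq hpq h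
    obtain ⟨c, hc⟩ := col (2 * k + 1) (dvd_of_ratio hα0 hq hpq h)
    exact comb_odd S SegCross k c hc
end
end
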